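/- arXiv:2007.05901 — 7 statements merged into one kernel-verified Lean document; each statement's English description precedes it below -/
import Mathlib

section
/- Every linear code C over GF(q) whose dual code C^⊥ has minimum distance at least 3 is monomially equivalent to a punctured code (H_{(q,m)}^⊥)^T of a Simplex code H_{(q,m)}^⊥ over GF(q), for some integer m ≥ 2 and some set T of coordinate positions. -/
open Finset

section Defs

variable {F : Type} [Field F]

/-- The dual of a linear code `C ⊆ F^ι` w.r.t. the standard inner product. -/
def dualCode {ι : Type} [Fintype ι] (C : Submodule F (ι → F)) :
    Submodule F (ι → F) where
  carrier := {x | ∀ c ∈ C, ∑ i, x i * c i = 0}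
  add_mem' := by
    intro a b ha hb c hc
    simp only [Set.mem_setOf_eq] at ha hb ⊢
    simp only [Pi.add_apply, add_mul, Finset.sum_add_distrib, ha c hc, hb c hc, add_zero]
  zero_mem' := by
    intro c hc
    simp
  smul_mem' := by
    intro r a ha c hc
    simp only [Set.mem_setOf_eq] at ha ⊢
    simp only [Pi.smul_apply, smul_eq_mul, mul_assoc, ← Finset.mul_sum, ha c hc, mul_zero]

/-- The subcode of codewords vanishing on every coordinate in `T`. -/
def zeroOn {ι : Type} (T : Finset ι) : Submodule F (ι → F) where
  carrier := {x | ∀ i ∈ T, x i = 0}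
  add_mem' := by
    intro a b ha hb i hi
    simp only [Set.mem_setOf_eq] at ha hb
    simp [Pi.add_apply, ha i hi, hb i hi]
  zero_mem' := by intro i _; simp
  smul_mem' := by
    intro r a ha i hi
    simp only [Set.mem_setOf_eq] at ha
    simp [Pi.smul_apply, ha i hi]

/-- Deleting the coordinates in `T`. -/
def restrictTo {ι : Type} (T : Finset ι) : (ι → F) →ₗ[F] ({i : ι // i ∉ T} → F) :=
  LinearMap.funLeft F F Subtype.val

/-- The punctured code `C^T`: delete the coordinates in `T` from every codeword. -/
def puncturedCode {ι : Type} (C : Submodule F (ι → F)) (T : Finset ι) :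
    Submodule F ({i : ι // i ∉ T} → F) :=
  C.map (restrictTo T)

/-- The shortened code `C_T`: take the codewords vanishing on `T`, then delete `T`. -/
def shortenedCode {ι : Type} (C : Submodule F (ι → F)) (T : Finset ι) :
    Submodule F ({i : ι // i ∉ T} → F) :=
  (C ⊓ zeroOn T).map (restrictTo T)

/-- The code `C` has minimum distance (exactly) `d`. -/
def IsMinDist {ι : Type} [Fintype ι] [DecidableEq F] (C : Submodule F (ι → F)) (d : ℕ) : Prop :=
  (∃ c ∈ C, c ≠ 0 ∧ hammingNorm c = d) ∧ ∀ c ∈ C, c ≠ 0 → d ≤ hammingNorm c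

/-- `A_k(C)`: the number of codewords of Hamming weight `k` in `C`. -/
noncomputable def weightCount {ι : Type} [Fintype ι] [DecidableEq F]
    (C : Submodule F (ι → F)) (k : ℕ) : ℕ :=
  Nat.card {c : ι → F // c ∈ C ∧ hammingNorm c = k}

/-- A monomial transformation: permute the coordinates and scale each coordinate. -/
def monomialMap {ι κ : Type} (σ : ι ≃ κ) (u : κ → F) : (ι → F) →ₗ[F] (κ → F) where
  toFun x := fun j => u j * x (σ.symm j)
  map_add' a b := by
    funext j
    simp [Pi.add_apply, mul_add]
  map_smul' r a := by
    funext j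
    simp only [Pi.smul_apply, smul_eq_mul, RingHom.id_apply]
    ring

/-- Monomial equivalence of linear codes. -/
def MonomiallyEquiv {ι κ : Type} (C : Submodule F (ι → F)) (D : Submodule F (κ → F)) : Prop :=
  ∃ (σ : ι ≃ κ) (u : κ → F), (∀ j, u j ≠ 0) ∧ D = C.map (monomialMap σ u)

/-- The syndrome map attached to a parity-check matrix with columns `v i`. -/
def checkMap {m n : ℕ} (v : Fin n → (Fin m → F)) : (Fin n → F) →ₗ[F] (Fin m → F) where
  toFun x := fun j => ∑ i, x i * v i j
  map_add' a b := by
    funext j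
    simp [Pi.add_apply, add_mul, Finset.sum_add_distrib]
  map_smul' r a := by
    funext j
    simp [Pi.smul_apply, Finset.mul_sum, mul_assoc]

/-- `v` lists exactly one nonzero vector from each one-dimensional subspace of `F^m`. -/
def IsHammingMatrix {m n : ℕ} (v : Fin n → (Fin m → F)) : Prop :=
  (∀ i, v i ≠ 0) ∧ ∀ w : Fin m → F, w ≠ 0 → ∃! i : Fin n, ∃ c : F, w = c • v i

/-- The Hamming code attached to a parity-check matrix whose columns are the `v i`. -/
def hammingCode {m n : ℕ} (v : Fin n → (Fin m → F)) : Submodule F (Fin n → F) :=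
  LinearMap.ker (checkMap v)

/-- The Simplex code: the dual of the Hamming code. -/
def simplexCode {m n : ℕ} (v : Fin n → (Fin m → F)) : Submodule F (Fin n → F) :=
  dualCode (hammingCode v)

end Defs

theorem mem_simplex_iff {F : Type} [Field F] {m n : ℕ} (v : Fin n → (Fin m → F)) (y : Fin n → F) :
    y ∈ simplexCode v ↔ ∃ a : Fin m → F, ∀ i, y i = ∑ k, a k * v i k := by
  constructor
  · intro hy
    have hy' : ∀ x, checkMap v x = 0 → ∑ i, y i * x i = 0 := fun x hx => hy x hx
    let φ : Module.Dual F (Fin n → F) := Fintype.linearCombination F y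
    have hφ : φ ∈ (LinearMap.ker (checkMap v)).dualAnnihilator := by
      rw [Submodule.mem_dualAnnihilator]
      intro x hx
      have := hy' x hx
      simp only [φ, Fintype.linearCombination_apply, smul_eq_mul]
      rw [← this]
      exact Finset.sum_congr rfl fun i _ => mul_comm _ _
    rw [← LinearMap.range_dualMap_eq_dualAnnihilator_ker] at hφ
    obtain ⟨ψ, hψ⟩ := hφ
    refine ⟨fun k => ψ (Pi.single k 1), fun i => ?_⟩
    have h1 : φ (Pi.single i 1) = y i := by
      simp [φ, Fintype.linearCombination_apply, Pi.single_apply]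
    have h2 : checkMap v (Pi.single i 1) = v i := by
      funext j
      simp [checkMap, Pi.single_apply]
    rw [← h1, ← hψ, LinearMap.dualMap_apply, h2]
    rw [LinearMap.pi_apply_eq_sum_univ ψ (v i)]
    refine Finset.sum_congr rfl fun k _ => ?_
    rw [smul_eq_mul, mul_comm]
    congr 2
    funext j
    simp [Pi.single_apply, eq_comm]
  · rintro ⟨a, ha⟩ x hx
    have hx' : ∀ j, ∑ i, x i * v i j = 0 := fun j => congrFun (show checkMap v x = 0 from hx) j
    calc ∑ i, y i * x i = ∑ i, ∑ k, a k * (x i * v i k) := by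
          refine Finset.sum_congr rfl fun i _ => ?_
          rw [ha, Finset.sum_mul]
          exact Finset.sum_congr rfl fun k _ => by ring
      _ = ∑ k, a k * ∑ i, x i * v i k := by
          rw [Finset.sum_comm]
          simp [Finset.mul_sum]
      _ = 0 := by simp [hx']

theorem exists_hamming {F : Type} [Field F] [Fintype F] (m : ℕ) :
    ∃ (nn : ℕ) (v : Fin nn → (Fin m → F)), IsHammingMatrix v := by
  classical
  haveI : Finite (Projectivization F (Fin m → F)) := by
    unfold Projectivization; infer_instance
  obtain ⟨nn, ⟨e⟩⟩ := Finite.exists_equiv_fin (Projectivization F (Fin m → F))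
  refine ⟨nn, fun i => (e.symm i).rep, fun i => Projectivization.rep_nonzero _, fun w hw => ?_⟩
  refine ⟨e (Projectivization.mk F w hw), ?_, ?_⟩
  · obtain ⟨a, ha⟩ := Projectivization.exists_smul_eq_mk_rep F w hw
    refine ⟨((a⁻¹ : Fˣ) : F), ?_⟩
    simp only [Equiv.symm_apply_apply]
    rw [← ha, ← Units.smul_def, inv_smul_smul]
  · rintro i ⟨c, hc⟩
    rw [← Equiv.symm_apply_eq, ← Projectivization.mk_rep (e.symm i)]
    rw [Projectivization.mk_eq_mk_iff']
    have hc0 : c ≠ 0 := by rintro rfl; simp at hc; exact hw hc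
    exact ⟨c⁻¹, by rw [hc, inv_smul_smul₀ hc0]⟩

theorem cols_indep {F : Type} [Field F] [DecidableEq F] {n e : ℕ}
    (C : Submodule F (Fin n → F)) (he : IsMinDist (dualCode C) e) (he3 : 3 ≤ e)
    (i j : Fin n) (b d : F) (hx : (Pi.single i b + Pi.single j d : Fin n → F) ≠ 0)
    (h : ∀ c ∈ C, b * c i + d * c j = 0) : False := by
  have h1 := he.2 (Pi.single i b + Pi.single j d) (by
    intro c hc
    rw [← h c hc]
    simp [add_mul, Finset.sum_add_distrib, Pi.single_apply]) hx
  have h2 : hammingNorm (Pi.single i b + Pi.single j d : Fin n → F) ≤ 2 := by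
    refine le_trans (Finset.card_le_card (t := {i, j}) ?_) Finset.card_le_two
    intro k hk
    simp only [Finset.mem_filter, Finset.mem_univ, true_and, Pi.add_apply] at hk
    by_contra hk'
    simp only [Finset.mem_insert, Finset.mem_singleton, not_or] at hk'
    apply hk
    simp [Pi.single_apply, hk'.1, hk'.2]
  omega

/-- Every linear code over `GF(q)` whose dual has minimum distance at least `3` is
(up to monomial equivalence) a punctured code of a Simplex code over `GF(q)`. -/
theorem statement1 {F : Type} [Field F] [Fintype F] [DecidableEq F] {n e : ℕ}
    (C : Submodule F (Fin n → F)) (he : IsMinDist (dualCode C) e) (he3 : 3 ≤ e) :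
    ∃ (m nn : ℕ), 2 ≤ m ∧
      ∃ v : Fin nn → (Fin m → F), IsHammingMatrix v ∧
        ∃ T : Finset (Fin nn),
          MonomiallyEquiv C (puncturedCode (simplexCode v) T) := by
  classical
  obtain ⟨P, hP⟩ := LinearMap.exists_leftInverse_of_injective C.subtype (by simp)
  have hP' : ∀ c (hc : c ∈ C), P c = ⟨c, hc⟩ := fun c hc => LinearMap.congr_fun hP ⟨c, hc⟩
  let G : (Fin (n + 2) → F) →ₗ[F] (Fin n → F) :=
    C.subtype ∘ₗ P ∘ₗ LinearMap.funLeft F F (Fin.castAdd 2)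
  have hGC : ∀ a, G a ∈ C := fun a => (P _).2
  have hGs : ∀ c ∈ C, ∃ a, G a = c := by
    intro c hc
    refine ⟨Fin.append c 0, ?_⟩
    have : LinearMap.funLeft F F (Fin.castAdd 2) (Fin.append c (0 : Fin 2 → F)) = c := by
      funext j
      simp [LinearMap.funLeft_apply]
    simp only [G, LinearMap.comp_apply, this, hP' c hc, Submodule.subtype_apply]
  let g : Fin n → (Fin (n + 2) → F) := fun j k => G (Pi.single k 1) j
  have hGg : ∀ a j, G a j = ∑ k, a k * g j k := by
    intro a j
    rw [LinearMap.pi_apply_eq_sum_univ G a, Finset.sum_apply]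
    refine Finset.sum_congr rfl fun k _ => ?_
    simp only [g, Pi.smul_apply, smul_eq_mul]
    have hs : (fun l => if k = l then (1 : F) else 0) = Pi.single k 1 := by
      funext l
      simp [Pi.single_apply, eq_comm]
    rw [hs]
  have hg0 : ∀ j, g j ≠ 0 := by
    intro j hj
    refine cols_indep C he he3 j j 1 0 (by simp) fun c hc => ?_
    obtain ⟨a, rfl⟩ := hGs c hc
    simp [hGg, hj]
  obtain ⟨nn, v, hv⟩ := exists_hamming (F := F) (n + 2)
  choose f hf using fun j => (hv.2 (g j) (hg0 j)).exists
  choose c hc using hf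
  have hc0 : ∀ j, c j ≠ 0 := by
    intro j hj
    apply hg0 j
    rw [hc, hj, zero_smul]
  have hfi : Function.Injective f := by
    intro i j hij
    by_contra hne
    refine cols_indep C he he3 i j (c j) (-c i) ?_ fun x hx => ?_
    · intro h
      have := congrFun h i
      simp [Pi.single_apply, hne] at this
      exact hc0 j this
    · obtain ⟨a, rfl⟩ := hGs x hx
      rw [hGg, hGg, hc i, hc j, hij, Finset.mul_sum, Finset.mul_sum, ← Finset.sum_add_distrib]
      refine Finset.sum_eq_zero fun k _ => ?_
      simp only [Pi.smul_apply, smul_eq_mul]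
      ring
  refine ⟨n + 2, nn, by omega, v, hv, (Finset.univ.image f)ᶜ, ?_⟩
  let σ : Fin n ≃ {i : Fin nn // i ∉ (Finset.univ.image f)ᶜ} :=
    Equiv.ofBijective (fun j => ⟨f j, by simp⟩) (by
      constructor
      · intro i j hij
        exact hfi (congrArg Subtype.val hij)
      · rintro ⟨i, hi⟩
        have : ∃ j, f j = i := by simpa using hi
        obtain ⟨j, rfl⟩ := this
        exact ⟨j, rfl⟩)
  have key : ∀ a, (fun j => (c (σ.symm j))⁻¹ * G a (σ.symm j)) = fun j => ∑ k, a k * v j.1 k := by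
    intro a
    funext j
    obtain ⟨i, rfl⟩ := σ.surjective j
    simp only [Equiv.symm_apply_apply]
    rw [hGg, hc i, Finset.mul_sum]
    refine Finset.sum_congr rfl fun k _ => ?_
    have : (σ i).1 = f i := rfl
    rw [this, Pi.smul_apply, smul_eq_mul]
    field_simp [hc0 i]
  refine ⟨σ, fun j => (c (σ.symm j))⁻¹, fun j => inv_ne_zero (hc0 _), ?_⟩
  ext z
  constructor
  · rintro ⟨y, hy, rfl⟩
    obtain ⟨a, ha⟩ := (mem_simplex_iff v y).1 hy
    refine ⟨G a, hGC a, ?_⟩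
    refine (key a).trans ?_
    funext j
    exact (ha j.1).symm
  · rintro ⟨x, hx, rfl⟩
    obtain ⟨a, rfl⟩ := hGs x hx
    refine ⟨fun i => ∑ k, a k * v i k, (mem_simplex_iff v _).2 ⟨a, fun i => rfl⟩, ?_⟩
    exact (key a).symm
end

section
/- Every linear code C over GF(q) with minimum distance at least 3 is monomially equivalent to a shortened code (H_{(q,m)})_T of a Hamming code H_{(q,m)} over GF(q), for some integer m ≥ 2 and some set T of coordinate positions. -/
open Finset

/-- Every linear code over `GF(q)` with minimum distance at least `3` is
(up to monomial equivalence) a shortened code of a Hamming code over `GF(q)`. -/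
theorem statement2 {F : Type} [Field F] [Fintype F] [DecidableEq F] {n d : ℕ}
    (C : Submodule F (Fin n → F)) (hd : IsMinDist C d) (hd3 : 3 ≤ d) :
    ∃ (m nn : ℕ), 2 ≤ m ∧
      ∃ v : Fin nn → (Fin m → F), IsHammingMatrix v ∧
        ∃ T : Finset (Fin nn),
          MonomiallyEquiv C (shortenedCode (hammingCode v) T) := by
  classical
  obtain ⟨⟨c0, hc0, hc0n, hc0d⟩, hmin⟩ := hd
  have hn : 3 ≤ n := by
    have h1 : hammingNorm c0 ≤ Fintype.card (Fin n) := hammingNorm_le_card_fintype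
    simp at h1
    omega
  obtain ⟨D, hD⟩ := Submodule.exists_isCompl C
  obtain ⟨f, hf⟩ : ∃ f : (Fin n → F) →ₗ[F] (Fin n → F), LinearMap.ker f = C :=
    ⟨D.subtype ∘ₗ Submodule.linearProjOfIsCompl D C hD.symm, by
      rw [LinearMap.ker_comp_of_ker_eq_bot _ D.ker_subtype]
      exact Submodule.linearProjOfIsCompl_ker hD.symm⟩
  have hmem : ∀ x, x ∈ C ↔ f x = 0 := fun x => by rw [← hf, LinearMap.mem_ker]
  have hfx : ∀ x, f x = ∑ i, x i • f (Pi.single i 1) := by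
    intro x
    exact LinearMap.pi_apply_eq_sum_univ f x |>.trans (by
      refine Finset.sum_congr rfl fun i _ => ?_
      congr 2
      funext j
      simp [Pi.single_apply, eq_comm])
  -- low weight vectors in C vanish
  have hlow : ∀ x ∈ C, ∀ i j : Fin n, (∀ k, k ≠ i → k ≠ j → x k = 0) → x = 0 := by
    intro x hx i j hk
    by_contra hne
    have h1 := hmin x hx hne
    have h2 : hammingNorm x ≤ ({i, j} : Finset (Fin n)).card := by
      unfold hammingNorm
      apply Finset.card_le_card
      intro k hkk
      simp only [Finset.mem_filter, Finset.mem_univ, true_and] at hkk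
      simp only [Finset.mem_insert, Finset.mem_singleton]
      by_contra hcon
      push Not at hcon
      exact hkk (hk k hcon.1 hcon.2)
    have h3 : ({i, j} : Finset (Fin n)).card ≤ 2 := Finset.card_le_two
    omega
  have hh0 : ∀ i, f (Pi.single i 1) ≠ 0 := by
    intro i h0
    have h1 := hlow (Pi.single i 1) ((hmem _).2 h0) i i (by
      intro k hk _
      simp [Pi.single_apply, hk])
    have := congrFun h1 i
    simp at this
  let P : Fin n → Projectivization F (Fin n → F) :=
    fun i => Projectivization.mk F (f (Pi.single i 1)) (hh0 i)
  have hP : Function.Injective P := by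
    intro i j hij
    by_contra hne
    obtain ⟨a, ha⟩ := (Projectivization.mk_eq_mk_iff' F _ _ _ _).1 hij
    have h1 := hlow (a • Pi.single j 1 - Pi.single i 1) ((hmem _).2 (by
      rw [map_sub, map_smul, ha, sub_self])) i j (by
      intro k hk hk'
      simp [Pi.single_apply, hk, hk'])
    have := congrFun h1 i
    simp [Pi.single_apply, hne] at this
  haveI : Finite (Projectivization F (Fin n → F)) := by
    unfold Projectivization
    infer_instance
  obtain ⟨nn, ⟨e⟩⟩ := Finite.exists_equiv_fin (Projectivization F (Fin n → F))
  let v : Fin nn → (Fin n → F) := fun k => (e.symm k).rep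
  let κ : Fin n → Fin nn := fun i => e (P i)
  have hκ : Function.Injective κ := e.injective.comp hP
  have ha : ∀ i, ∃ a : Fˣ, a • f (Pi.single i 1) = v (κ i) := by
    intro i
    have := Projectivization.exists_smul_eq_mk_rep F (f (Pi.single i 1)) (hh0 i)
    simpa [v, κ, P] using this
  choose a ha using ha
  have ha' : ∀ i, f (Pi.single i 1) = ((a i)⁻¹ : Fˣ) • v (κ i) := by
    intro i
    rw [← ha i, inv_smul_smul]
  let T : Finset (Fin nn) := Finset.univ.filter (fun k => k ∉ Set.range κ)
  have hT : ∀ i, κ i ∉ T := by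
    intro i
    simp [T]
  let σ : Fin n ≃ {k : Fin nn // k ∉ T} :=
    Equiv.ofBijective (fun i => ⟨κ i, hT i⟩) ⟨fun i j hij => hκ (congrArg Subtype.val hij), by
      rintro ⟨k, hk⟩
      have hk2 : k ∈ Set.range κ := by
        by_contra hcon
        exact hk (by simpa [T] using hcon)
      obtain ⟨i, rfl⟩ := hk2
      exact ⟨i, rfl⟩⟩
  have hσ : ∀ i, ((σ i : {k : Fin nn // k ∉ T}) : Fin nn) = κ i := fun i => rfl
  have hsum : ∀ z : Fin nn → F, (∀ k ∈ T, z k = 0) →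
      checkMap v z = ∑ i, z (κ i) • v (κ i) := by
    intro z hz
    have h1 : checkMap v z = ∑ k, z k • v k := by
      funext j
      simp [checkMap, Finset.sum_apply]
    rw [h1]
    symm
    apply Fintype.sum_of_injective κ hκ
    · intro k hk
      rw [hz k (by simpa [T] using hk), zero_smul]
    · intro i
      rfl
  refine ⟨n, nn, by omega, v, ⟨fun k => Projectivization.rep_nonzero _, ?_⟩, T, σ,
    fun k => (((a (σ.symm k))⁻¹ : Fˣ) : F), fun k => Units.ne_zero _, ?_⟩
  · intro w hw
    refine ⟨e (Projectivization.mk F w hw), ?_, ?_⟩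
    · obtain ⟨b, hb⟩ := Projectivization.exists_smul_eq_mk_rep F w hw
      refine ⟨((b⁻¹ : Fˣ) : F), ?_⟩
      simp only [v, Equiv.symm_apply_apply]
      rw [← hb]
      exact (inv_smul_smul b w).symm
    · rintro k ⟨c, hc⟩
      rw [← Equiv.symm_apply_eq, ← Projectivization.mk_rep (e.symm k)]
      symm
      rw [Projectivization.mk_eq_mk_iff']
      exact ⟨c, hc.symm⟩
  · ext y
    constructor
    · rintro ⟨z, ⟨hz1, hz2⟩, rfl⟩
      have hz1' : checkMap v z = 0 := hz1
      rw [hsum z hz2] at hz1'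
      refine ⟨fun i => (a i : F) * z (κ i), ?_, ?_⟩
      · refine (hmem _).2 ?_
        rw [hfx, ← hz1']
        refine Finset.sum_congr rfl fun i _ => ?_
        rw [ha' i, Units.smul_def, smul_smul]
        congr 1
        rw [mul_comm, Units.inv_mul_cancel_left]
      · funext k
        obtain ⟨i, rfl⟩ := σ.surjective k
        simp [monomialMap, restrictTo, LinearMap.funLeft_apply, hσ]
    · rintro ⟨x, hx, rfl⟩
      let z : Fin nn → F := fun k =>
        if h : k ∉ T then (((a (σ.symm ⟨k, h⟩))⁻¹ : Fˣ) : F) * x (σ.symm ⟨k, h⟩) else 0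
      have hzT : ∀ k ∈ T, z k = 0 := by
        intro k hk
        simp [z, hk]
      have hzκ : ∀ i, z (κ i) = (((a i)⁻¹ : Fˣ) : F) * x i := by
        intro i
        have h1 : σ.symm ⟨κ i, hT i⟩ = i := (Equiv.symm_apply_eq σ).2 rfl
        simp only [z]
        rw [dif_pos (hT i), h1]
      refine ⟨z, ⟨?_, hzT⟩, ?_⟩
      · change checkMap v z = 0
        rw [hsum z hzT, ← (hmem x).1 hx, hfx]
        refine Finset.sum_congr rfl fun i _ => ?_
        rw [ha' i, Units.smul_def, smul_smul, hzκ, mul_comm]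
      · funext k
        obtain ⟨i, rfl⟩ := σ.surjective k
        change z (κ i) = _
        rw [hzκ]
        simp [monomialMap]
end

section
/- Let C be an [n, k, d] code over GF(q), let d^⊥ be the minimum distance of the dual code C^⊥, and let t be an integer with 1 ≤ t < min{d, d^⊥}. Then for any set T of t coordinate positions, the punctured code C^T has length n−t, dimension k, and minimum distance at least d−t. Furthermore, if A_d(C) > q^k − q^{k−t}(q−1)^t − 1 and t ≤ k, then the minimum distance of C^T equals exactly d−t. -/
open Finset

lemma aux_norm {F : Type} [Field F] [DecidableEq F] {n : ℕ} (T : Finset (Fin n)) (c : Fin n → F) :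
    hammingNorm c = hammingNorm (restrictTo T c) + (T.filter (fun i => c i ≠ 0)).card := by
  classical
  have h1 : hammingNorm (restrictTo T c) = ((univ.filter (fun i => c i ≠ 0)).filter (fun i => i ∉ T)).card := by
    unfold hammingNorm
    rw [← Finset.card_map (Function.Embedding.subtype (fun i => i ∉ T))]
    congr 1
    ext i
    simp only [Finset.mem_map, mem_filter, mem_univ, true_and]
    constructor
    · rintro ⟨j, hj, rfl⟩
      exact ⟨hj, j.2⟩
    · rintro ⟨h1, h2⟩
      exact ⟨⟨i, h2⟩, h1, rfl⟩
  have h2 : (T.filter (fun i => c i ≠ 0)) = ((univ.filter (fun i => c i ≠ 0)).filter (fun i => ¬ i ∉ T)) := by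
    ext i
    simp
    tauto
  rw [h1, h2, Finset.card_filter_add_card_filter_not]
  rfl

lemma aux_surj {F : Type} [Field F] [DecidableEq F] {n dperp : ℕ} (C : Submodule F (Fin n → F))
    (hdp : IsMinDist (dualCode C) dperp) (T : Finset (Fin n)) (hT : T.card < dperp) :
    Function.Surjective ((LinearMap.funLeft F F (Subtype.val : T → Fin n)).comp C.subtype) := by
  classical
  rw [← LinearMap.range_eq_top]
  by_contra hne
  obtain ⟨f, hf0, hf⟩ := Submodule.exists_le_ker_of_lt_top _ (lt_top_iff_ne_top.2 hne)
  have hfx : ∀ v : T → F, f v = ∑ i : T, v i * f (Pi.single i 1) := by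
    intro v
    conv_lhs => rw [pi_eq_sum_univ' v]
    simp [map_sum]
  let x : Fin n → F := fun i => if h : i ∈ T then f (Pi.single ⟨i, h⟩ 1) else 0
  have hxm : x ∈ dualCode C := by
    intro c hc
    have := hf (LinearMap.mem_range_self _ ⟨c, hc⟩)
    rw [LinearMap.mem_ker, hfx] at this
    rw [← this]
    have e : ∑ i, x i * c i = ∑ i ∈ T, x i * c i := by
      symm
      apply Finset.sum_subset (Finset.subset_univ _)
      intro i _ hi
      simp [x, hi]
    rw [e, ← Finset.sum_coe_sort]
    apply Finset.sum_congr rfl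
    intro i _
    simp [x, LinearMap.funLeft_apply, mul_comm]
  have hx0 : x ≠ 0 := by
    intro h
    apply hf0
    ext v
    have : ∀ i : T, f (Pi.single i 1) = 0 := by
      intro i
      have := congrFun h i
      simpa [x] using this
    simp [this]
  have h1 := hdp.2 x hxm hx0
  have h2 : hammingNorm x ≤ T.card := by
    apply Finset.card_le_card
    intro i hi
    by_contra h
    simp [x, h] at hi
  omega

lemma aux_count {F : Type} [Field F] [Fintype F] [DecidableEq F] {n k t : ℕ}
    (C : Submodule F (Fin n → F)) [Fintype C]
    (hk : Module.finrank F ↥C = k) (T : Finset (Fin n)) (hT : T.card = t) (htk : t ≤ k)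
    (hs : Function.Surjective ((LinearMap.funLeft F F (Subtype.val : T → Fin n)).comp C.subtype)) :
    (univ.filter (fun c : C => ∀ i ∈ T, c.1 i ≠ 0)).card =
      Fintype.card F ^ (k - t) * (Fintype.card F - 1) ^ t := by
  classical
  set π := (LinearMap.funLeft F F (Subtype.val : T → Fin n)).comp C.subtype with hπ
  obtain ⟨m, hm⟩ : ∃ m, ∀ y, (univ.filter (fun c : C => π c = y)).card = m := by
    refine ⟨(univ.filter (fun c : C => π c = 0)).card, fun y => ?_⟩
    obtain ⟨c0, hc0⟩ := hs y
    symm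
    apply Finset.card_bij (fun c _ => c + c0)
    · intro c hc
      simp at hc ⊢
      rw [hc, hc0, zero_add]
    · intro a _ b _ h
      exact add_right_cancel h
    · intro b hb
      refine ⟨b - c0, ?_, by simp⟩
      simp only [mem_filter, mem_univ, true_and] at hb ⊢
      rw [map_sub, hb, hc0, sub_self]
  have hq : 0 < Fintype.card F := Fintype.card_pos
  have hC : Fintype.card C = Fintype.card F ^ k := by
    rw [← hk]; exact Module.card_eq_pow_finrank
  have hall : Fintype.card C = Fintype.card F ^ t * m := by
    rw [← Finset.card_univ, Finset.card_eq_sum_card_fiberwise (f := π) (t := univ) (by simp)]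
    simp [hm, hT]
  have hmv : m = Fintype.card F ^ (k - t) := by
    rw [hC] at hall
    apply Nat.eq_of_mul_eq_mul_left (pow_pos hq t)
    rw [← hall, ← pow_add]; congr 1; omega
  have hS : (Fintype.piFinset (fun _ : T => (univ.filter (fun a : F => a ≠ 0)))).card
      = (Fintype.card F - 1) ^ t := by
    simp [Finset.filter_ne', Finset.card_erase_of_mem, hT]
  rw [Finset.card_eq_sum_card_fiberwise (f := π)
    (t := Fintype.piFinset (fun _ : T => (univ.filter (fun a : F => a ≠ 0))))]
  · rw [← hS, ← hmv, mul_comm, ← smul_eq_mul, ← Finset.sum_const]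
    apply Finset.sum_congr rfl
    intro y hy
    rw [← hm y, Finset.filter_filter]
    congr 1
    ext c
    simp only [mem_filter, mem_univ, true_and, and_iff_right_iff_imp]
    rintro rfl i hi
    simp only [Fintype.mem_piFinset, mem_filter, mem_univ, true_and] at hy
    exact hy ⟨i, hi⟩
  · intro c hc
    simp only [coe_filter, mem_univ, true_and, Set.mem_setOf_eq] at hc
    simp only [mem_coe, Fintype.mem_piFinset, mem_filter, mem_univ, true_and]
    intro i
    exact hc i i.2



/-- Parameters of the punctured code `C^T` when `|T| = t < min{d, d^⊥}`, and the exact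
minimum distance `d - t` when `A_d(C) > q^k - q^{k-t}(q-1)^t - 1` and `t ≤ k`. -/
theorem statement3 {F : Type} [Field F] [Fintype F] [DecidableEq F]
    {n k d dperp t : ℕ} (C : Submodule F (Fin n → F))
    (hk : Module.finrank F ↥C = k) (hd : IsMinDist C d)
    (hdp : IsMinDist (dualCode C) dperp)
    (ht1 : 1 ≤ t) (htd : t < d) (htdp : t < dperp)
    (T : Finset (Fin n)) (hT : T.card = t) :
    Nat.card {i : Fin n // i ∉ T} = n - t ∧
    Module.finrank F ↥(puncturedCode C T) = k ∧
    (∀ c ∈ puncturedCode C T, c ≠ 0 → d - t ≤ hammingNorm c) ∧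
    (Fintype.card F ^ k - Fintype.card F ^ (k - t) * (Fintype.card F - 1) ^ t - 1
        < weightCount C d → t ≤ k →
      IsMinDist (puncturedCode C T) (d - t)) := by


  classical
  have hle : ∀ c : Fin n → F, (T.filter (fun i => c i ≠ 0)).card ≤ t := fun c =>
    hT ▸ Finset.card_filter_le _ _
  have hmin : ∀ c ∈ puncturedCode C T, c ≠ 0 → d - t ≤ hammingNorm c := by
    rintro _ ⟨c, hc, rfl⟩ h0
    have hc0 : c ≠ 0 := by
      rintro rfl
      exact h0 (map_zero _)
    have := hd.2 c hc hc0
    have := aux_norm T c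
    have := hle c
    omega
  refine ⟨?_, ?_, hmin, ?_⟩
  · simp [Fintype.card_subtype_compl, hT]
  · rw [← hk]
    have hinj : Function.Injective ((restrictTo T).domRestrict C) := by
      rw [← LinearMap.ker_eq_bot, LinearMap.ker_eq_bot']
      rintro ⟨c, hc⟩ h
      by_contra hne
      have hc0 : c ≠ 0 := fun h => hne (by simpa using h)
      have h3 : restrictTo T c = 0 := h
      have h1 := hd.2 c hc hc0
      have h2 := aux_norm T c
      rw [h3, hammingNorm_zero] at h2
      have := hle c
      omega
    have := LinearMap.finrank_range_of_inj hinj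
    rw [LinearMap.range_domRestrict] at this
    exact this
  · intro hA htk
    have hs := aux_surj C hdp T (by omega)
    have hcount := aux_count C hk T hT htk hs
    have hC : Fintype.card C = Fintype.card F ^ k := by
      rw [← hk]; exact Module.card_eq_pow_finrank
    have hex : ∃ c ∈ C, hammingNorm c = d ∧ ∀ i ∈ T, c i ≠ 0 := by
      by_contra! hno
      have hW : weightCount C d = (univ.filter (fun c : C => hammingNorm c.1 = d)).card := by
        unfold weightCount
        rw [← Fintype.card_subtype, ← Nat.card_eq_fintype_card]
        exact Nat.card_congr (Equiv.subtypeSubtypeEquivSubtypeInter (fun c => c ∈ C)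
          (fun c : Fin n → F => hammingNorm c = d)).symm
      have hsub : (univ.filter (fun c : C => hammingNorm c.1 = d)) ⊆
          (univ.filter (fun c : C => ¬ ∀ i ∈ T, c.1 i ≠ 0)).erase 0 := by
        intro c hc
        simp only [mem_filter, mem_univ, true_and] at hc
        simp only [mem_erase, mem_filter, mem_univ, true_and]
        refine ⟨?_, ?_⟩
        · rintro rfl
          simp at hc
          omega
        · intro h
          obtain ⟨i, hi, hi0⟩ := hno c.1 c.2 hc
          exact h i hi hi0
      have h0 : (0 : C) ∈ (univ.filter (fun c : C => ¬ ∀ i ∈ T, c.1 i ≠ 0)) := by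
        simp only [mem_filter, mem_univ, true_and]
        intro h
        obtain ⟨i, hi⟩ : T.Nonempty := Finset.card_pos.1 (by omega)
        exact h i hi rfl
      have h1 := Finset.card_le_card hsub
      rw [Finset.card_erase_of_mem h0, ← hW] at h1
      have h2 := Finset.card_filter_add_card_filter_not (s := (univ : Finset C))
        (fun c : C => ∀ i ∈ T, c.1 i ≠ 0)
      rw [hcount, Finset.card_univ, hC] at h2
      omega
    obtain ⟨c, hc, hcd, hcT⟩ := hex
    have hn := aux_norm T c
    rw [Finset.filter_true_of_mem hcT] at hn
    refine ⟨⟨restrictTo T c, ⟨c, hc, rfl⟩, ?_, by omega⟩, hmin⟩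
    intro h
    rw [h, hammingNorm_zero] at hn
    omega
end

section
/- Let C be an [n, k, d] code over GF(q), let d^⊥ be the minimum distance of the dual code C^⊥, and let t be an integer with 1 ≤ t < min{d, d^⊥}. Then for any set T of t coordinate positions, the code (C_T)^⊥ (the dual of the shortened code C_T) has length n−t, dimension n−k, and minimum distance at least d^⊥−t. Furthermore, if A_{d^⊥}(C^⊥) > q^{n−k} − q^{n−k−t}(q−1)^t − 1 and t ≤ n−k, then the minimum distance of (C_T)^⊥ equals exactly d^⊥−t. -/
open Finset

theorem aux_finrank_dual {F : Type} [Field F] {ι : Type} [Fintype ι]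
    (C : Submodule F (ι → F)) :
    Module.finrank F C + Module.finrank F (dualCode C) = Fintype.card ι := by
  classical
  have h : dualCode C = C.dualAnnihilator.map (dotProductEquiv F ι).symm.toLinearMap := by
    ext x
    rw [Submodule.mem_map_equiv, LinearEquiv.symm_symm, Submodule.mem_dualAnnihilator]
    rfl
  rw [h, LinearEquiv.finrank_map_eq, Subspace.finrank_add_finrank_dualAnnihilator_eq]
  simp

theorem aux_dual_dual {F : Type} [Field F] {ι : Type} [Fintype ι]
    (C : Submodule F (ι → F)) : dualCode (dualCode C) = C := by
  symm
  apply Submodule.eq_of_le_of_finrank_le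
  · intro c hc x hx
    have := hx c hc
    simpa [mul_comm] using this
  · have h1 := aux_finrank_dual C
    have h2 := aux_finrank_dual (dualCode C)
    omega

/-- projection to the coordinates in `T`. -/
def projOn {F : Type} [Field F] {ι : Type} (T : Finset ι) : (ι → F) →ₗ[F] (T → F) :=
  LinearMap.funLeft F F Subtype.val

theorem aux_small {F : Type} [Field F] [DecidableEq F] {ι : Type} [Fintype ι]
    (x : ι → F) (T : Finset ι) (h : ∀ i, i ∉ T → x i = 0) : hammingNorm x ≤ T.card := by
  unfold hammingNorm
  apply Finset.card_le_card
  intro i hi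
  by_contra hc
  simp [h i hc] at hi

theorem aux_weight {F : Type} [Field F] [DecidableEq F] {ι : Type} [Fintype ι] [DecidableEq ι]
    (x : ι → F) (T : Finset ι) :
    hammingNorm x = hammingNorm (restrictTo T x) + (T.filter (fun i => x i ≠ 0)).card := by
  have h1 : hammingNorm (restrictTo T x)
      = ((univ.filter (fun i => x i ≠ 0)).filter (fun i => i ∉ T)).card := by
    unfold hammingNorm restrictTo
    rw [← Finset.card_map (Function.Embedding.subtype (fun i => i ∉ T))]
    congr 1
    ext i
    simp only [Finset.mem_map, Finset.mem_filter, Finset.mem_univ, true_and]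
    constructor
    · rintro ⟨a, ha, rfl⟩
      exact ⟨ha, a.2⟩
    · rintro ⟨h1, h2⟩
      exact ⟨⟨i, h2⟩, h1, rfl⟩
  have h2 : T.filter (fun i => x i ≠ 0) = (univ.filter (fun i => x i ≠ 0)).filter (fun i => i ∈ T) := by
    ext i; simp [and_comm]
  rw [h1, h2, add_comm, Finset.card_filter_add_card_filter_not]
  rfl

theorem aux_ker {F : Type} [Field F] {ι : Type} [Fintype ι]
    (C : Submodule F (ι → F)) (T : Finset ι) :
    Module.finrank F C ≤ Module.finrank F (shortenedCode C T) + T.card := by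
  have h := LinearMap.finrank_range_add_finrank_ker ((projOn T).domRestrict C)
  have h1 : Module.finrank F (LinearMap.range ((projOn T).domRestrict C)) ≤ T.card := by
    refine (Submodule.finrank_le _).trans ?_
    simp
  have h2 : Module.finrank F (LinearMap.ker ((projOn T).domRestrict C))
      ≤ Module.finrank F (shortenedCode C T) := by
    have key : ∀ x : LinearMap.ker ((projOn T).domRestrict C), ∀ i ∈ T, (x : C).1 i = 0 := by
      intro x i hi
      have := congrFun (LinearMap.mem_ker.1 x.2) ⟨i, hi⟩
      simpa [projOn, LinearMap.funLeft_apply] using this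
    let g : LinearMap.ker ((projOn T).domRestrict C) →ₗ[F] shortenedCode C T :=
      LinearMap.codRestrict (shortenedCode C T)
        ((restrictTo T).comp (C.subtype.comp (LinearMap.ker ((projOn T).domRestrict C)).subtype))
        (fun x => ⟨x.1.1, ⟨x.1.2, key x⟩, rfl⟩)
    apply LinearMap.finrank_le_finrank_of_injective (f := g)
    intro x y hx
    apply Subtype.ext
    apply Subtype.ext
    funext i
    by_cases hi : i ∈ T
    · exact (key x i hi).trans (key y i hi).symm
    · exact congrFun (congrArg Subtype.val hx) ⟨i, hi⟩
  omega

theorem aux_inj {F : Type} [Field F] [DecidableEq F] {ι : Type} [Fintype ι]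
    (D : Submodule F (ι → F)) (T : Finset ι)
    (h : ∀ c ∈ D, c ≠ 0 → T.card < hammingNorm c) :
    Module.finrank F (D.map (restrictTo T)) = Module.finrank F D := by
  have : Function.Injective ((restrictTo T).domRestrict D) := by
    rw [← LinearMap.ker_eq_bot, LinearMap.ker_eq_bot']
    intro x hx
    by_contra hne
    have h1 := h x.1 x.2 (fun h0 => hne (Subtype.ext h0))
    have h2 := aux_small x.1 T (fun i hi => congrFun hx ⟨i, hi⟩)
    omega
  rw [← LinearMap.range_domRestrict, LinearMap.finrank_range_of_inj this]

theorem aux_split {F : Type} [Field F] {ι : Type} [Fintype ι] [DecidableEq ι]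
    (T : Finset ι) (f : ι → F) :
    ∑ i, f i = ∑ i : T, f i + ∑ i : {i // i ∉ T}, f i := by
  rw [← Fintype.sum_subtype_add_sum_subtype (fun i => i ∈ T) f]
  congr 1
  exact Finset.sum_congr (by ext; simp) (fun _ _ => rfl)

theorem aux_eq {F : Type} [Field F] [DecidableEq F] {ι : Type} [Fintype ι] [DecidableEq ι]
    (C : Submodule F (ι → F)) (T : Finset ι)
    (h : ∀ c ∈ dualCode C, c ≠ 0 → T.card < hammingNorm c) :
    (dualCode C).map (restrictTo T) = dualCode (shortenedCode C T) := by
  apply Submodule.eq_of_le_of_finrank_le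
  · rintro _ ⟨x, hx, rfl⟩ _ ⟨c, ⟨hc, hz⟩, rfl⟩
    have h1 := hx c hc
    rw [aux_split T] at h1
    have h2 : ∑ i : T, x i * c i = 0 :=
      Finset.sum_eq_zero (fun i _ => by rw [hz i.1 i.2, mul_zero])
    rw [h2, zero_add] at h1
    exact h1
  · rw [aux_inj _ T h]
    have h1 := aux_finrank_dual C
    have h2 := aux_finrank_dual (shortenedCode C T)
    have h3 := aux_ker C T
    have h4 : Fintype.card {i // i ∉ T} = Fintype.card ι - T.card := by
      rw [Fintype.card_subtype_compl]; simp
    have h5 : T.card ≤ Fintype.card ι := Finset.card_le_univ T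
    omega

theorem aux_surj_s4 {F : Type} [Field F] [DecidableEq F] {ι : Type} [Fintype ι] [DecidableEq ι]
    (C : Submodule F (ι → F)) (T : Finset ι)
    (h : ∀ c ∈ C, c ≠ 0 → T.card < hammingNorm c) :
    Function.Surjective ((projOn T).domRestrict (dualCode C)) := by
  rw [← LinearMap.range_eq_top]
  by_contra hne
  obtain ⟨f, hf, hle⟩ := Submodule.exists_le_ker_of_lt_top _ (lt_top_iff_ne_top.2 hne)
  let y : T → F := (dotProductEquiv F T).symm f
  have hy : ∀ v, ∑ i, y i * v i = f v := by
    intro v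
    have : dotProductEquiv F T y v = f v := by simp [y]
    exact this
  let z : ι → F := fun i => if hi : i ∈ T then y ⟨i, hi⟩ else 0
  have hz : z ∈ C := by
    rw [← aux_dual_dual C]
    intro x hx
    rw [aux_split T]
    have h2 : ∑ i : {i // i ∉ T}, z i * x i = 0 :=
      Finset.sum_eq_zero (fun i _ => by simp [z, i.2])
    have h3 : ∑ i : T, z i * x i = ∑ i : T, y i * (projOn T x) i :=
      Finset.sum_congr rfl (fun i _ => by simp [z, projOn, LinearMap.funLeft_apply])
    rw [h2, h3, add_zero, hy]
    exact hle ⟨⟨x, hx⟩, rfl⟩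
  have hz0 : z ≠ 0 := by
    intro h0
    apply hf
    ext1 v
    have : y = 0 := by
      funext i
      have := congrFun h0 i.1
      simpa [z] using this
    have h5 : f = dotProductEquiv F T y := by simp [y]
    rw [h5, this, map_zero]
  have h1 := h z hz hz0
  have h2 := aux_small z T (fun i hi => by simp [z, hi])
  omega

theorem aux_count_s4 {F V W : Type} [Field F] [Fintype F] [AddCommGroup V] [AddCommGroup W]
    [Module F V] [Module F W] [Finite V] [Finite W]
    (f : V →ₗ[F] W) (hf : Function.Surjective f) (S : Set W) :
    Nat.card (f ⁻¹' S) = Nat.card S * Nat.card (LinearMap.ker f) := by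
  rw [← Nat.card_prod]
  let g := Function.surjInv hf
  have hg : ∀ w, f (g w) = w := Function.surjInv_eq hf
  refine Nat.card_congr ⟨fun x => (⟨f x.1, x.2⟩, ⟨x.1 - g (f x.1), by simp [hg]⟩),
    fun p => ⟨g p.1.1 + p.2.1, by
      have := LinearMap.mem_ker.1 p.2.2
      simp [hg, this]⟩, ?_, ?_⟩
  · intro x; simp
  · rintro ⟨⟨w, hw⟩, ⟨v, hv⟩⟩
    have := LinearMap.mem_ker.1 hv
    simp [hg, this]

theorem aux_full {F : Type} [Field F] [Fintype F] [DecidableEq F] {ι : Type} [Fintype ι]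
    [DecidableEq ι] (D : Submodule F (ι → F)) (T : Finset ι)
    (hs : Function.Surjective ((projOn T).domRestrict D)) :
    Nat.card {x : D // ∀ i ∈ T, x.1 i ≠ 0} =
      Fintype.card F ^ (Module.finrank F D - T.card) * (Fintype.card F - 1) ^ T.card := by
  have h := aux_count_s4 _ hs {y | ∀ i, y i ≠ 0}
  have h1 : Nat.card {y : T → F | ∀ i, y i ≠ 0} = (Fintype.card F - 1) ^ T.card := by
    have e : {y : T → F | ∀ i, y i ≠ 0} ≃ (T → {a : F // a ≠ 0}) :=
      Equiv.subtypePiEquivPi (p := fun (_ : T) (a : F) => a ≠ 0)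
    rw [Nat.card_congr e, Nat.card_fun, Nat.card_eq_fintype_card, Nat.card_eq_fintype_card,
      Fintype.card_coe]
    congr 1
    rw [Fintype.card_subtype_compl]
    simp
  have h2 : Nat.card (LinearMap.ker ((projOn T).domRestrict D)) =
      Fintype.card F ^ (Module.finrank F D - T.card) := by
    rw [Module.natCard_eq_pow_finrank (K := F), Nat.card_eq_fintype_card]
    have h3 := LinearMap.finrank_range_add_finrank_ker ((projOn T).domRestrict D)
    rw [LinearMap.range_eq_top.2 hs, finrank_top] at h3
    simp at h3
    congr 1
    omega
  rw [h1, h2, mul_comm] at h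
  rw [← h]
  apply Nat.card_congr
  apply Equiv.subtypeEquivRight
  intro x
  simp [projOn, LinearMap.funLeft_apply]

theorem aux_exists {F : Type} [Field F] [Fintype F] [DecidableEq F] {ι : Type} [Fintype ι]
    [DecidableEq ι] (D : Submodule F (ι → F)) (T : Finset ι) (w : ℕ) (hw : T.card < w)
    (hT : 1 ≤ T.card)
    (hs : Function.Surjective ((projOn T).domRestrict D))
    (hA : Fintype.card F ^ (Module.finrank F D) -
      Fintype.card F ^ (Module.finrank F D - T.card) * (Fintype.card F - 1) ^ T.card - 1
        < weightCount D w) :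
    ∃ x ∈ D, hammingNorm x = w ∧ ∀ i ∈ T, x i ≠ 0 := by
  classical
  by_contra! hc
  have hfull := aux_full D T hs
  rw [← hfull] at hA
  have hcard : Fintype.card F ^ (Module.finrank F D) = Fintype.card D := by
    rw [← Nat.card_eq_fintype_card (α := D), Module.natCard_eq_pow_finrank (K := F),
      Nat.card_eq_fintype_card]
  have hwc : weightCount D w = (univ.filter (fun x : D => hammingNorm x.1 = w)).card := by
    unfold weightCount
    rw [← Fintype.card_subtype, ← Nat.card_eq_fintype_card]
    exact Nat.card_congr (Equiv.subtypeSubtypeEquivSubtypeInter _ _).symm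
  have hPc : Nat.card {x : D // ∀ i ∈ T, x.1 i ≠ 0}
      = (univ.filter (fun x : D => ∀ i ∈ T, x.1 i ≠ 0)).card := by
    rw [Nat.card_eq_fintype_card, Fintype.card_subtype (fun x : D => ∀ i ∈ T, x.1 i ≠ 0)]
  rw [hcard, hwc, hPc] at hA
  set P := univ.filter (fun x : D => ∀ i ∈ T, x.1 i ≠ 0)
  set Q := univ.filter (fun x : D => hammingNorm x.1 = w)
  have hsub : insert 0 Q ⊆ Pᶜ := by
    intro x hx
    rw [Finset.mem_compl]
    intro hP
    have hP' : ∀ i ∈ T, x.1 i ≠ 0 := (Finset.mem_filter.1 hP).2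
    rcases Finset.mem_insert.1 hx with rfl | hx
    · obtain ⟨i, hi⟩ := Finset.card_pos.1 hT
      exact hP' i hi rfl
    · obtain ⟨i, hi, h0⟩ := hc x.1 x.2 (Finset.mem_filter.1 hx).2
      exact hP' i hi h0
  have h0 : (0 : D) ∉ Q := by
    intro h
    have := (Finset.mem_filter.1 h).2
    simp at this
    omega
  have h1 := Finset.card_le_card hsub
  rw [Finset.card_insert_of_notMem h0, Finset.card_compl] at h1
  omega

/-- Parameters of the dual `(C_T)^⊥` of the shortened code when `|T| = t < min{d, d^⊥}`,
and the exact minimum distance `d^⊥ - t` when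
`A_{d^⊥}(C^⊥) > q^{n-k} - q^{n-k-t}(q-1)^t - 1` and `t ≤ n - k`. -/
theorem statement4 {F : Type} [Field F] [Fintype F] [DecidableEq F]
    {n k d dperp t : ℕ} (C : Submodule F (Fin n → F))
    (hk : Module.finrank F ↥C = k) (hd : IsMinDist C d)
    (hdp : IsMinDist (dualCode C) dperp)
    (ht1 : 1 ≤ t) (htd : t < d) (htdp : t < dperp)
    (T : Finset (Fin n)) (hT : T.card = t) :
    Nat.card {i : Fin n // i ∉ T} = n - t ∧
    Module.finrank F ↥(dualCode (shortenedCode C T)) = n - k ∧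
    (∀ c ∈ dualCode (shortenedCode C T), c ≠ 0 → dperp - t ≤ hammingNorm c) ∧
    (Fintype.card F ^ (n - k) - Fintype.card F ^ (n - k - t) * (Fintype.card F - 1) ^ t - 1
        < weightCount (dualCode C) dperp → t ≤ n - k →
      IsMinDist (dualCode (shortenedCode C T)) (dperp - t)) := by
  subst hT
  have hD : ∀ c ∈ dualCode C, c ≠ 0 → T.card < hammingNorm c :=
    fun c hc h0 => htdp.trans_le (hdp.2 c hc h0)
  have hC : ∀ c ∈ C, c ≠ 0 → T.card < hammingNorm c :=
    fun c hc h0 => htd.trans_le (hd.2 c hc h0)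
  have hfr : Module.finrank F (dualCode C) = n - k := by
    have := aux_finrank_dual C
    simp at this
    omega
  have hlow : ∀ c ∈ dualCode (shortenedCode C T), c ≠ 0 → dperp - T.card ≤ hammingNorm c := by
    rw [← aux_eq C T hD]
    rintro _ ⟨x, hx, rfl⟩ h0
    have h1 := hdp.2 x hx (by rintro rfl; simp at h0)
    have h2 := aux_weight x T
    have h3 := Finset.card_filter_le T (fun i => x i ≠ 0)
    omega
  refine ⟨?_, ?_, hlow, ?_⟩
  · rw [Nat.card_eq_fintype_card, Fintype.card_subtype_compl]
    simp
  · rw [← aux_eq C T hD, aux_inj _ T hD, hfr]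
  · intro hA _
    refine ⟨?_, hlow⟩
    rw [← hfr] at hA
    obtain ⟨x, hx, hw, hn⟩ := aux_exists (dualCode C) T dperp htdp ht1 (aux_surj_s4 C T hC) hA
    have h2 := aux_weight x T
    rw [Finset.filter_true_of_mem hn] at h2
    have h3 : hammingNorm (restrictTo T x) = dperp - T.card := by omega
    refine ⟨restrictTo T x, ?_, ?_, h3⟩
    · rw [← aux_eq C T hD]
      exact ⟨x, hx, rfl⟩
    · intro h0
      rw [h0] at h3
      simp at h3
      omega
end

section
/- Let n = (q^m−1)/(q−1) ≥ 4 and let t_1 be any coordinate position of the Hamming code H_{(q,m)}. Then the shortened code (H_{(q,m)})_{{t_1}} is an [n−1, n−m−1, 3] code over GF(q), and its weight distribution satisfies n·A_k((H_{(q,m)})_{{t_1}}) = (n−k)·A_k(H_{(q,m)}) for all 0 ≤ k ≤ n−1. -/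
open Finset

section Helpers

variable {F : Type} [Field F]

lemma mem_hamming {m n : ℕ} (v : Fin n → (Fin m → F)) (x : Fin n → F) :
    x ∈ hammingCode v ↔ ∑ i, x i • v i = 0 := by
  unfold hammingCode
  rw [LinearMap.mem_ker]
  have : checkMap v x = ∑ i, x i • v i := by
    funext j
    simp [checkMap, Finset.sum_apply]
  rw [this]

lemma hm_inj {m n : ℕ} {v : Fin n → (Fin m → F)} (hv : IsHammingMatrix v) {i j : Fin n} {c : F}
    (h : v i = c • v j) : i = j :=
  (hv.2 (v i) (hv.1 i)).unique ⟨1, by simp⟩ ⟨c, h⟩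

lemma hm_indep {m n : ℕ} {v : Fin n → (Fin m → F)} (hv : IsHammingMatrix v) {i j : Fin n}
    (hij : i ≠ j) {a b : F} (h : a • v i + b • v j = 0) : a = 0 := by
  by_contra ha
  apply hij
  apply hm_inj hv (c := a⁻¹ * (-b))
  rw [mul_smul, neg_smul, ← eq_neg_of_add_eq_zero_left h, smul_smul, inv_mul_cancel₀ ha, one_smul]

lemma hm_third {m n : ℕ} {v : Fin n → (Fin m → F)} (hv : IsHammingMatrix v) {i j : Fin n}
    (hij : i ≠ j) : ∃ k, ∃ c : F, v i + v j = c • v k ∧ k ≠ i ∧ k ≠ j := by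
  have hne : v i + v j ≠ 0 := by
    intro h
    exact one_ne_zero (hm_indep hv hij (a := (1 : F)) (b := 1) (by simpa using h))
  obtain ⟨k, ⟨c, hc⟩, -⟩ := hv.2 _ hne
  refine ⟨k, c, hc, ?_, ?_⟩
  · rintro rfl
    apply one_ne_zero (hm_indep hv hij.symm (a := (1 : F)) (b := 1 - c) _)
    rw [sub_smul, ← hc]; simp
  · rintro rfl
    apply one_ne_zero (hm_indep hv hij (a := (1 : F)) (b := 1 - c) _)
    rw [sub_smul, ← hc]; simp

lemma hm_dist [DecidableEq F] {m n : ℕ} {v : Fin n → (Fin m → F)} (hv : IsHammingMatrix v)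
    (x : Fin n → F) (hx : x ∈ hammingCode v) (h0 : x ≠ 0) : 3 ≤ hammingNorm x := by
  rw [mem_hamming] at hx
  have hs : ∑ i ∈ (univ.filter fun i => x i ≠ 0), x i • v i = 0 := by
    rw [← hx]
    apply Finset.sum_subset (Finset.subset_univ _)
    intro i _ hi
    have : x i = 0 := by simpa using hi
    simp [this]
  have hpos := hammingNorm_pos_iff.2 h0
  by_contra hlt
  have h12 : hammingNorm x = 1 ∨ hammingNorm x = 2 := by omega
  unfold hammingNorm at h12
  rcases h12 with h | h
  · obtain ⟨i, hi⟩ := Finset.card_eq_one.1 h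
    have hxi : x i ≠ 0 := by
      have : i ∈ (univ.filter fun i => x i ≠ 0) := by rw [hi]; simp
      simpa using this
    rw [hi, Finset.sum_singleton] at hs
    rcases smul_eq_zero.1 hs with h | h
    · exact hxi h
    · exact hv.1 i h
  · obtain ⟨i, j, hij, hi⟩ := Finset.card_eq_two.1 h
    have hxi : x i ≠ 0 := by
      have : i ∈ (univ.filter fun i => x i ≠ 0) := by rw [hi]; simp
      simpa using this
    rw [hi, Finset.sum_pair hij] at hs
    exact hxi (hm_indep hv hij hs)

lemma norm_restrict [DecidableEq F] {n : ℕ} (t : Fin n) (x : Fin n → F) (h : x t = 0) :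
    hammingNorm (restrictTo ({t} : Finset (Fin n)) x) = hammingNorm x := by
  unfold hammingNorm
  apply Finset.card_bij (fun a _ => a.1)
  · intro a ha
    exact Finset.mem_filter.2 ⟨Finset.mem_univ _, (Finset.mem_filter.1 ha).2⟩
  · intro a _ b _ hab
    exact Subtype.ext hab
  · intro b hb
    have hb' : x b ≠ 0 := by simpa using hb
    refine ⟨⟨b, ?_⟩, ?_, rfl⟩
    · rw [Finset.mem_singleton]; rintro rfl; exact hb' h
    · exact Finset.mem_filter.2 ⟨Finset.mem_univ _, hb'⟩

lemma restrict_inj {n : ℕ} (t : Fin n) {x y : Fin n → F} (hx : x t = 0) (hy : y t = 0)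
    (h : restrictTo ({t} : Finset (Fin n)) x = restrictTo ({t} : Finset (Fin n)) y) : x = y := by
  funext i
  by_cases hi : i = t
  · rw [hi, hx, hy]
  · exact congrFun h ⟨i, by simpa using hi⟩

lemma mem_short {m n : ℕ} (v : Fin n → (Fin m → F)) (t : Fin n)
    (y : {i : Fin n // i ∉ ({t} : Finset (Fin n))} → F) :
    y ∈ shortenedCode (hammingCode v) {t} ↔
      ∃ x ∈ hammingCode v, x t = 0 ∧ restrictTo ({t} : Finset (Fin n)) x = y := by
  unfold shortenedCode
  rw [Submodule.mem_map]
  constructor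
  · rintro ⟨x, ⟨h1, h2⟩, h3⟩
    exact ⟨x, h1, h2 t (by simp), h3⟩
  · rintro ⟨x, h1, h2, h3⟩
    refine ⟨x, ⟨h1, ?_⟩, h3⟩
    intro i hi
    rw [Finset.mem_singleton] at hi
    rw [hi]; exact h2

lemma weightCount_short [DecidableEq F] [Fintype F] {m n : ℕ} (v : Fin n → (Fin m → F))
    (t : Fin n) (k : ℕ) :
    weightCount (shortenedCode (hammingCode v) {t}) k =
      Nat.card {x : Fin n → F // (x ∈ hammingCode v ∧ hammingNorm x = k) ∧ x t = 0} := by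
  unfold weightCount
  symm
  apply Nat.card_eq_of_bijective (fun x => ⟨restrictTo ({t} : Finset (Fin n)) x.1,
    (mem_short v t _).2 ⟨x.1, x.2.1.1, x.2.2, rfl⟩,
    (norm_restrict t x.1 x.2.2).trans x.2.1.2⟩)
  constructor
  · intro x y h
    exact Subtype.ext (restrict_inj t x.2.2 y.2.2 (congrArg Subtype.val h))
  · rintro ⟨y, h1, h2⟩
    obtain ⟨x, hx, ht, rfl⟩ := (mem_short v t y).1 h1
    exact ⟨⟨x, ⟨hx, (norm_restrict t x ht).symm.trans h2⟩, ht⟩, rfl⟩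

lemma exists_aut {V : Type} [AddCommGroup V] [Module F V] {a b : V}
    (ha : a ≠ 0) (hb : b ≠ 0) : ∃ g : V ≃ₗ[F] V, g a = b := by
  let f := (LinearEquiv.toSpanNonzeroSingleton F V a ha).symm ≪≫ₗ
    LinearEquiv.toSpanNonzeroSingleton F V b hb
  obtain ⟨g, hg⟩ := Submodule.exists_linearEquiv_restrict_eq f
  refine ⟨g, ?_⟩
  have h := hg (LinearEquiv.toSpanNonzeroSingleton F V a ha 1)
  simp only [f, LinearEquiv.trans_apply, LinearEquiv.symm_apply_apply] at h
  simpa using h.symm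

lemma count_le [DecidableEq F] [Fintype F] {m n : ℕ} {v : Fin n → (Fin m → F)}
    (hv : IsHammingMatrix v) (s t : Fin n) (k : ℕ) :
    Nat.card {x : Fin n → F // (x ∈ hammingCode v ∧ hammingNorm x = k) ∧ x s = 0} ≤
      Nat.card {x : Fin n → F // (x ∈ hammingCode v ∧ hammingNorm x = k) ∧ x t = 0} := by
  obtain ⟨g, hg⟩ := exists_aut (F := F) (hv.1 t) (hv.1 s)
  have hex : ∀ i, ∃ j, ∃ c : F, g (v i) = c • v j := fun i =>
    (hv.2 (g (v i)) (by simpa using hv.1 i)).exists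
  choose σ a hσ using hex
  have ha : ∀ i, a i ≠ 0 := by
    intro i h
    have := hσ i
    rw [h, zero_smul] at this
    exact hv.1 i (by simpa using this)
  have hinj : Function.Injective σ := by
    intro i j hij
    apply hm_inj hv (c := a i * (a j)⁻¹)
    apply g.injective
    rw [map_smul, hσ, hσ, hij, smul_smul, mul_assoc, inv_mul_cancel₀ (ha j), mul_one]
  have hbij : Function.Bijective σ := Finite.injective_iff_bijective.1 hinj
  have hst : σ t = s := by
    symm
    exact hm_inj hv (c := a t) (by rw [← hg, hσ])
  have hmem : ∀ x ∈ hammingCode v, (fun i => (a i)⁻¹ * x (σ i)) ∈ hammingCode v := by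
    intro x hx
    rw [mem_hamming] at hx ⊢
    apply g.injective
    rw [map_sum, map_zero, ← hx, ← hbij.sum_comp (fun i => x i • v i)]
    apply Finset.sum_congr rfl
    intro i _
    rw [map_smul, hσ, smul_smul]
    congr 1
    field_simp [ha i]
  have hnorm : ∀ x : Fin n → F, hammingNorm (fun i => (a i)⁻¹ * x (σ i)) = hammingNorm x := by
    intro x
    unfold hammingNorm
    apply Finset.card_bij (fun i _ => σ i)
    · intro i hi
      simpa [ha i] using hi
    · intro i _ j _ h
      exact hinj h
    · intro j hj
      obtain ⟨i, rfl⟩ := hbij.2 j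
      exact ⟨i, by simpa [ha i] using hj, rfl⟩
  apply Nat.card_le_card_of_injective (fun x => ⟨fun i => (a i)⁻¹ * x.1 (σ i),
    ⟨hmem x.1 x.2.1.1, (hnorm x.1).trans x.2.1.2⟩, by
      show (a t)⁻¹ * x.1 (σ t) = 0
      rw [hst, x.2.2, mul_zero]⟩)
  intro x y h
  apply Subtype.ext
  funext j
  obtain ⟨i, rfl⟩ := hbij.2 j
  have := congrFun (congrArg Subtype.val h) i
  exact mul_left_cancel₀ (inv_ne_zero (ha i)) this

lemma count_main [DecidableEq F] [Fintype F] {m n : ℕ} {v : Fin n → (Fin m → F)}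
    (hv : IsHammingMatrix v) (t : Fin n) (k : ℕ) :
    n * weightCount (shortenedCode (hammingCode v) {t}) k
        = (n - k) * weightCount (hammingCode v) k := by
  classical
  rw [weightCount_short]
  unfold weightCount
  have e1 : ∀ s : Fin n,
      Nat.card {x : Fin n → F // (x ∈ hammingCode v ∧ hammingNorm x = k) ∧ x t = 0} =
      ((univ.filter fun x : Fin n → F => x ∈ hammingCode v ∧ hammingNorm x = k).filter
        fun x => x s = 0).card := by
    intro s
    rw [le_antisymm (count_le hv t s k) (count_le hv s t k), Nat.card_eq_fintype_card,
      Fintype.card_subtype, Finset.filter_filter]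
  rw [Nat.card_eq_fintype_card (α := {c : Fin n → F // c ∈ hammingCode v ∧ hammingNorm c = k}),
    Fintype.card_subtype]
  set S := (univ.filter fun x : Fin n → F => x ∈ hammingCode v ∧ hammingNorm x = k) with hS
  have h1 : ∑ s : Fin n, (S.filter fun x => x s = 0).card =
      n * Nat.card {x : Fin n → F // (x ∈ hammingCode v ∧ hammingNorm x = k) ∧ x t = 0} := by
    rw [Finset.sum_congr rfl (fun s _ => (e1 s).symm)]
    simp
  rw [← h1]
  have h2 := Finset.sum_card_bipartiteAbove_eq_sum_card_bipartiteBelow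
    (s := (univ : Finset (Fin n))) (t := S) (fun s x => x s = 0)
  unfold Finset.bipartiteAbove Finset.bipartiteBelow at h2
  rw [h2, Finset.sum_const_nat (m := n - k), mul_comm]
  intro x hx
  have hk : hammingNorm x = k := (Finset.mem_filter.1 hx).2.2
  have := Finset.card_filter_add_card_filter_not (s := (univ : Finset (Fin n))) (fun i => x i = 0)
  rw [Finset.card_univ, Fintype.card_fin] at this
  unfold hammingNorm at hk
  simp only [ne_eq] at hk
  show (univ.filter fun i => x i = 0).card = n - k
  omega

lemma finrank_short {m n : ℕ} (hn : 4 ≤ n) {v : Fin n → (Fin m → F)}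
    (hv : IsHammingMatrix v) (t : Fin n) :
    Module.finrank F ↥(shortenedCode (hammingCode v) {t}) = n - m - 1 := by
  classical
  let φ : ({i : Fin n // i ∉ ({t} : Finset (Fin n))} → F) →ₗ[F] (Fin m → F) :=
    Fintype.linearCombination F (fun i => v i.1)
  have hφ : ∀ y, φ y = ∑ i, y i • v i.1 := fun y => Fintype.linearCombination_apply ..
  have hsum : ∀ x : Fin n → F, x t = 0 →
      ∑ i, x i • v i = φ (restrictTo ({t} : Finset (Fin n)) x) := by
    intro x hx
    rw [hφ]
    symm
    have := Finset.sum_subtype (p := fun i => i ∉ ({t} : Finset (Fin n)))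
      (F := inferInstance) (univ.erase t)
      (by intro i; simp) (fun i => x i • v i)
    rw [show (∑ i : {i : Fin n // i ∉ ({t} : Finset (Fin n))},
      (restrictTo ({t} : Finset (Fin n)) x) i • v i.1) =
      ∑ i : {i : Fin n // i ∉ ({t} : Finset (Fin n))}, x i.1 • v i.1 from rfl, ← this]
    apply Finset.sum_erase
    simp [hx]
  have hker : shortenedCode (hammingCode v) {t} = LinearMap.ker φ := by
    ext y
    rw [mem_short, LinearMap.mem_ker]
    constructor
    · rintro ⟨x, hx, ht, rfl⟩
      rw [mem_hamming] at hx
      rw [← hsum x ht, hx]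
    · intro hy
      let x : Fin n → F := fun i => if h : i ∉ ({t} : Finset (Fin n)) then y ⟨i, h⟩ else 0
      have hxt : x t = 0 := by simp [x]
      have hr : restrictTo ({t} : Finset (Fin n)) x = y := by
        funext i
        show x i.1 = y i
        simp only [x]
        rw [dif_pos i.2]
      refine ⟨x, ?_, hxt, hr⟩
      rw [mem_hamming, hsum x hxt, hr, hy]
  have hne : ∀ i, i ≠ t → v i ∈ LinearMap.range φ := by
    intro i hi
    refine ⟨Pi.single ⟨i, by simpa using hi⟩ 1, ?_⟩
    simp [φ]
  have hall : ∀ i, v i ∈ LinearMap.range φ := by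
    intro i
    by_cases hi : i = t
    · subst hi
      have : Nontrivial (Fin n) := Fin.nontrivial_iff_two_le.2 (by omega)
      obtain ⟨j, hj⟩ := exists_ne i
      obtain ⟨k, c, hc, hki, hkj⟩ := hm_third hv hj.symm
      rw [eq_sub_of_add_eq hc]
      exact Submodule.sub_mem _ (Submodule.smul_mem _ _ (hne k hki)) (hne j hj)
    · exact hne i hi
  have hrange : LinearMap.range φ = ⊤ := by
    rw [eq_top_iff]
    intro w _
    by_cases hw : w = 0
    · rw [hw]; exact Submodule.zero_mem _
    · obtain ⟨i, ⟨c, hc⟩, -⟩ := hv.2 w hw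
      rw [hc]
      exact Submodule.smul_mem _ _ (hall i)
  have hrn := LinearMap.finrank_range_add_finrank_ker φ
  rw [hrange, finrank_top, Module.finrank_fin_fun, Module.finrank_fintype_fun_eq_card] at hrn
  have hc : Fintype.card {i : Fin n // i ∉ ({t} : Finset (Fin n))} = n - 1 := by
    simp
  rw [hc] at hrn
  rw [hker]
  omega

lemma exists_three [DecidableEq F] {m n : ℕ} (hn : 4 ≤ n) {v : Fin n → (Fin m → F)}
    (hv : IsHammingMatrix v) (t : Fin n) :
    ∃ x ∈ hammingCode v, x t = 0 ∧ x ≠ 0 ∧ hammingNorm x = 3 := by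
  have key : ∀ (i j k : Fin n) (a b c : F), i ≠ t → j ≠ t → k ≠ t → i ≠ j → k ≠ j → b ≠ 0 →
      a • v i + b • v j + c • v k = 0 →
      ∃ x ∈ hammingCode v, x t = 0 ∧ x ≠ 0 ∧ hammingNorm x = 3 := by
    intro i j k a b c hi hj hk hij hkj hb h
    let x : Fin n → F := Pi.single i a + Pi.single j b + Pi.single k c
    have hx : x ∈ hammingCode v := by
      rw [mem_hamming, ← h]
      simp [x, add_smul, Finset.sum_add_distrib, Pi.single_apply, ite_smul]
    have h0 : x ≠ 0 := by
      intro h0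
      apply hb
      have := congrFun h0 j
      simpa [x, Pi.single_apply, hij.symm, hkj.symm] using this
    refine ⟨x, hx, ?_, h0, le_antisymm ?_ (hm_dist hv x hx h0)⟩
    · simp [x, Pi.single_apply, hi.symm, hj.symm, hk.symm]
    · unfold hammingNorm
      refine le_trans (Finset.card_le_card (t := {i, j, k}) ?_) Finset.card_le_three
      intro l hl
      by_contra hl2
      simp only [Finset.mem_insert, Finset.mem_singleton, not_or] at hl2
      have : x l ≠ 0 := by simpa using hl
      apply this
      simp [x, Pi.single_apply, hl2.1, hl2.2.1, hl2.2.2]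
  have : Nontrivial (Fin n) := Fin.nontrivial_iff_two_le.2 (by omega)
  obtain ⟨i, hi⟩ := exists_ne t
  obtain ⟨k, c, hc, hkt, hki⟩ := hm_third hv hi.symm
  obtain ⟨j, hj⟩ : ∃ j, j ∉ ({t, i, k} : Finset (Fin n)) := by
    by_contra hall
    push Not at hall
    have h1 : (univ : Finset (Fin n)).card ≤ ({t, i, k} : Finset (Fin n)).card :=
      Finset.card_le_card (fun j _ => hall j)
    have h2 : ({t, i, k} : Finset (Fin n)).card ≤ 3 := Finset.card_le_three
    rw [Finset.card_univ, Fintype.card_fin] at h1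
    omega
  simp only [Finset.mem_insert, Finset.mem_singleton, not_or] at hj
  obtain ⟨hjt, hji, hjk⟩ := hj
  obtain ⟨l, d, hd, hli, hlj⟩ := hm_third hv (Ne.symm hji)
  by_cases hlt : l = t
  · subst hlt
    refine key i j k (1 + d) 1 (-(d * c)) hi hjt hkt (Ne.symm hji) (Ne.symm hjk) one_ne_zero ?_
    have e : v l = c • v k - v i := eq_sub_of_add_eq hc
    have e2 : v j = d • v l - v i := by rw [← hd]; abel
    rw [e2, e]
    module
  · refine key i j l 1 1 (-d) hi hjt hlt (Ne.symm hji) hlj one_ne_zero ?_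
    rw [one_smul, one_smul, hd]
    module

end Helpers

/-- The shortened Hamming code `(H_{(q,m)})_{{t₁}}` is an `[n-1, n-m-1, 3]` code and
`n · A_k((H_{(q,m)})_{{t₁}}) = (n-k) · A_k(H_{(q,m)})` for all `0 ≤ k ≤ n-1`. -/
theorem statement5 {F : Type} [Field F] [Fintype F] [DecidableEq F] {m n : ℕ}
    (hq : n * (Fintype.card F - 1) = Fintype.card F ^ m - 1) (hn : 4 ≤ n)
    (v : Fin n → (Fin m → F)) (hv : IsHammingMatrix v) (t1 : Fin n) :
    Nat.card {i : Fin n // i ∉ ({t1} : Finset (Fin n))} = n - 1 ∧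
    Module.finrank F ↥(shortenedCode (hammingCode v) {t1}) = n - m - 1 ∧
    IsMinDist (shortenedCode (hammingCode v) {t1}) 3 ∧
    ∀ k ≤ n - 1,
      n * weightCount (shortenedCode (hammingCode v) {t1}) k
        = (n - k) * weightCount (hammingCode v) k := by
  refine ⟨by simp, finrank_short hn hv t1, ⟨?_, ?_⟩, fun k _ => count_main hv t1 k⟩
  · obtain ⟨x, hx, ht, h0, h3⟩ := exists_three hn hv t1
    have hnr := norm_restrict t1 x ht
    refine ⟨restrictTo {t1} x, (mem_short v t1 _).2 ⟨x, hx, ht, rfl⟩, ?_, hnr.trans h3⟩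
    rw [← hammingNorm_ne_zero_iff, hnr, h3]
    norm_num
  · intro c hc h0
    obtain ⟨x, hx, ht, rfl⟩ := (mem_short v t1 c).1 hc
    rw [norm_restrict t1 x ht]
    apply hm_dist hv x hx
    rintro rfl
    exact h0 (map_zero _)
end

section
/- Let n = (q^m−1)/(q−1) ≥ 4 and let t_1 be any coordinate position. Then the dual code ((H_{(q,m)})_{{t_1}})^⊥ of the shortened Hamming code is an [n−1, m, q^{m−1}−1] code over GF(q) with weight enumerator 1 + (q−1)q^{m−1} z^{q^{m−1}−1} + (q^{m−1}−1) z^{q^{m−1}}. -/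
open Finset

section Helpers

variable {F : Type} [Field F]

def evMap {m n : ℕ} (v : Fin n → (Fin m → F)) (t : Fin n) :
    (Fin m → F) →ₗ[F] ({i : Fin n // i ∉ ({t} : Finset (Fin n))} → F) where
  toFun u := fun i => ∑ j, u j * v i.1 j
  map_add' a b := by
    funext i
    simp [add_mul, Finset.sum_add_distrib]
  map_smul' r a := by
    funext i
    simp [Finset.mul_sum, mul_assoc]

def subCheck {m n : ℕ} (v : Fin n → (Fin m → F)) (t : Fin n) :
    ({i : Fin n // i ∉ ({t} : Finset (Fin n))} → F) →ₗ[F] (Fin m → F) where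
  toFun x := fun j => ∑ i, x i * v i.1 j
  map_add' a b := by
    funext j
    simp [add_mul, Finset.sum_add_distrib]
  map_smul' r a := by
    funext j
    simp [Finset.mul_sum, mul_assoc]

lemma sum_sub {n : ℕ} (t : Fin n) (f : Fin n → F) (h : f t = 0) :
    ∑ i : {i : Fin n // i ∉ ({t} : Finset (Fin n))}, f i.1 = ∑ i, f i := by
  have h1 : ∑ i ∈ ({t} : Finset (Fin n))ᶜ, f i
      = ∑ i : {i : Fin n // i ∉ ({t} : Finset (Fin n))}, f i.1 :=
    Finset.sum_subtype _ (by simp) f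
  rw [← h1, ← Finset.sum_compl_add_sum ({t} : Finset (Fin n))]
  simp [h]

lemma shortened_eq {m n : ℕ} (v : Fin n → (Fin m → F)) (t : Fin n) :
    shortenedCode (hammingCode v) {t} = LinearMap.ker (subCheck v t) := by
  ext y
  simp only [shortenedCode, Submodule.mem_map, LinearMap.mem_ker]
  constructor
  · rintro ⟨x, ⟨hx, hz⟩, rfl⟩
    have hxt : x t = 0 := hz t (by simp)
    funext j
    have := congrFun (show checkMap v x = 0 from hx) j
    change ∑ i : {i : Fin n // i ∉ ({t} : Finset (Fin n))}, x i.1 * v i.1 j = 0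
    rw [sum_sub t (fun i => x i * v i j) (by simp [hxt])]
    exact this
  · intro hy
    let x : Fin n → F := fun i => if h : i ∉ ({t} : Finset (Fin n)) then y ⟨i, h⟩ else 0
    have hxt : x t = 0 := by simp [x]
    have hxy : ∀ i : {i : Fin n // i ∉ ({t} : Finset (Fin n))}, x i.1 = y i := by
      intro i
      simp only [x]
      rw [dif_pos i.2]
    refine ⟨x, ⟨?_, ?_⟩, ?_⟩
    · change checkMap v x = 0
      funext j
      change ∑ i, x i * v i j = 0
      rw [← sum_sub t (fun i => x i * v i j) (by simp [hxt])]
      have := congrFun hy j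
      change ∑ i, y i * v i.1 j = 0 at this
      simpa [hxy] using this
    · intro i hi
      rw [Finset.mem_singleton] at hi
      rw [hi, hxt]
    · funext i
      exact hxy i

lemma dual_eq {m n : ℕ} (v : Fin n → (Fin m → F)) (t : Fin n) :
    dualCode (shortenedCode (hammingCode v) {t}) = LinearMap.range (evMap v t) := by
  rw [shortened_eq]
  ext x
  constructor
  · intro hx
    let φ : Module.Dual F ({i : Fin n // i ∉ ({t} : Finset (Fin n))} → F) :=
      Fintype.linearCombination F x
    have hφ : φ ∈ (LinearMap.ker (subCheck v t)).dualAnnihilator := by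
      rw [Submodule.mem_dualAnnihilator]
      intro w hw
      have := hx w hw
      simpa [φ, Fintype.linearCombination_apply, mul_comm] using this
    rw [← LinearMap.range_dualMap_eq_dualAnnihilator_ker] at hφ
    obtain ⟨g, hg⟩ := hφ
    refine ⟨fun j => g (Pi.single j 1), ?_⟩
    funext i
    have h1 := LinearMap.congr_fun hg (Pi.single i 1)
    have h2 : φ (Pi.single i 1) = x i := by
      simp [φ]
    have h3 : subCheck v t (Pi.single i 1) = v i.1 := by
      funext j
      simp [subCheck, Pi.single_apply]
    rw [h2, LinearMap.dualMap_apply, h3] at h1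
    rw [← h1]
    conv_rhs => rw [← Finset.univ_sum_single (v i.1)]
    change ∑ j, g (Pi.single j 1) * v i.1 j = _
    rw [map_sum]
    refine Finset.sum_congr rfl fun j _ => ?_
    have : (Pi.single j (v i.1 j) : Fin m → F) = v i.1 j • Pi.single j 1 := by
      rw [← Pi.single_smul]; simp
    rw [this, map_smul, smul_eq_mul, mul_comm]
  · rintro ⟨u, rfl⟩ c hc
    have hc' : ∀ j, ∑ i, c i * v i.1 j = 0 := fun j =>
      congrFun (show subCheck v t c = 0 from hc) j
    change ∑ i, (∑ j, u j * v i.1 j) * c i = 0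
    simp only [Finset.sum_mul]
    rw [Finset.sum_comm]
    refine Finset.sum_eq_zero fun j _ => ?_
    rw [← mul_zero (u j), ← hc' j, Finset.mul_sum]
    refine Finset.sum_congr rfl fun i _ => by ring

variable [Fintype F] [DecidableEq F]

lemma card_ker {m : ℕ} (a : Fin m → F) (ha : a ≠ 0) :
    #{w : Fin m → F | ∑ j, w j * a j = 0} = Fintype.card F ^ (m - 1) := by
  let φ : (Fin m → F) →ₗ[F] F := Fintype.linearCombination F a
  have hφ : ∀ w, φ w = ∑ j, w j * a j := by
    intro w; simp [φ, Fintype.linearCombination_apply]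
  have hs : Function.Surjective φ := by
    apply LinearMap.surjective
    intro h
    apply ha
    funext j
    have := LinearMap.congr_fun h (Pi.single j 1)
    simpa [φ] using this
  have h1 := LinearMap.finrank_range_add_finrank_ker φ
  rw [LinearMap.range_eq_top.2 hs, finrank_top] at h1
  simp only [Module.finrank_self, Module.finrank_fin_fun] at h1
  have h2 := Module.natCard_eq_pow_finrank (K := F) (V := LinearMap.ker φ)
  rw [show Module.finrank F (LinearMap.ker φ) = m - 1 by omega, Nat.card_eq_fintype_card (α := F)] at h2
  rw [← h2, ← Fintype.card_subtype, ← Nat.card_eq_fintype_card]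
  refine Nat.card_congr (Equiv.subtypeEquivRight fun w => ?_)
  rw [LinearMap.mem_ker, hφ]

lemma card_nker {m : ℕ} (a : Fin m → F) (ha : a ≠ 0) :
    #{w : Fin m → F | ∑ j, w j * a j ≠ 0} =
      (Fintype.card F - 1) * Fintype.card F ^ (m - 1) := by
  have h := Finset.card_filter_add_card_filter_not (s := (univ : Finset (Fin m → F)))
    (fun w => ∑ j, w j * a j = 0)
  rw [card_ker a ha] at h
  have hm : m ≠ 0 := by
    rintro rfl
    exact ha (Subsingleton.elim _ _)
  obtain ⟨k, rfl⟩ := Nat.exists_eq_succ_of_ne_zero hm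
  simp only [Finset.card_univ, Fintype.card_fun, Fintype.card_fin, Nat.succ_eq_add_one,
    Nat.add_sub_cancel, pow_succ] at h ⊢
  rw [Nat.sub_mul, mul_comm (Fintype.card F), one_mul]
  exact Nat.eq_sub_of_add_eq' h

lemma full_weight {m n : ℕ} (v : Fin n → (Fin m → F)) (hv : IsHammingMatrix v)
    (u : Fin m → F) (hu : u ≠ 0) :
    #{i : Fin n | ∑ j, u j * v i j ≠ 0} = Fintype.card F ^ (m - 1) := by
  have hq : 0 < Fintype.card F - 1 := by
    have := Fintype.one_lt_card (α := F); omega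
  apply Nat.eq_of_mul_eq_mul_left hq
  rw [← card_nker u hu, mul_comm, ← Fintype.card_units, ← Finset.card_univ (α := Fˣ),
    ← Finset.card_product]
  have key : ∀ (c : F) i, ∑ j, (c • v i) j * u j = c * ∑ j, u j * v i j := by
    intro c i
    rw [Finset.mul_sum]
    refine Finset.sum_congr rfl fun j _ => ?_
    simp only [Pi.smul_apply, smul_eq_mul]; ring
  refine Finset.card_bij (fun p _ => (p.2 : F) • v p.1) ?_ ?_ ?_
  · rintro ⟨i, c⟩ h
    simp only [Finset.mem_product, Finset.mem_filter, Finset.mem_univ, true_and, and_true] at h ⊢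
    rw [key]
    exact mul_ne_zero c.ne_zero h
  · rintro ⟨i, c⟩ h ⟨i', c'⟩ h' heq
    simp only at heq
    have hne : (c : F) • v i ≠ 0 := smul_ne_zero c.ne_zero (hv.1 i)
    have hi : i = i' := (hv.2 _ hne).unique ⟨c, rfl⟩ ⟨c', heq⟩
    subst hi
    have := smul_left_injective F (hv.1 i) heq
    rw [Units.ext this]
  · intro w hw
    simp only [Finset.mem_filter, Finset.mem_univ, true_and] at hw
    have hw0 : w ≠ 0 := by rintro rfl; simp at hw
    obtain ⟨i, ⟨c, rfl⟩, -⟩ := hv.2 w hw0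
    rw [key] at hw
    refine ⟨⟨i, Units.mk0 c (left_ne_zero_of_mul hw)⟩, ?_, rfl⟩
    simpa using right_ne_zero_of_mul hw

lemma weight_ev {m n : ℕ} (v : Fin n → (Fin m → F)) (hv : IsHammingMatrix v) (t : Fin n)
    (u : Fin m → F) (hu : u ≠ 0) :
    hammingNorm (evMap v t u) =
      if ∑ j, u j * v t j = 0 then Fintype.card F ^ (m - 1)
      else Fintype.card F ^ (m - 1) - 1 := by
  have h1 : hammingNorm (evMap v t u) = #(({i : Fin n | ∑ j, u j * v i j ≠ 0} : Finset _).erase t) := by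
    rw [hammingNorm, ← Finset.card_map (Function.Embedding.subtype _)]
    congr 1
    ext i
    simp only [Finset.mem_map, Finset.mem_filter, Finset.mem_univ, true_and, Finset.mem_erase]
    constructor
    · rintro ⟨⟨a, ha⟩, h, rfl⟩
      exact ⟨by simpa using ha, h⟩
    · rintro ⟨ha, h⟩
      exact ⟨⟨i, by simpa using ha⟩, h, rfl⟩
  rw [h1, ← full_weight v hv u hu]
  split_ifs with h
  · rw [Finset.erase_eq_of_notMem]
    simpa using h
  · rw [Finset.card_erase_of_mem]
    simpa using h

end Helpers

/-- The dual `((H_{(q,m)})_{{t₁}})^⊥` of the shortened Hamming code is an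
`[n-1, m, q^{m-1}-1]` code with weight enumerator
`1 + (q-1)q^{m-1} z^{q^{m-1}-1} + (q^{m-1}-1) z^{q^{m-1}}`. -/
theorem statement7 {F : Type} [Field F] [Fintype F] [DecidableEq F] {m n : ℕ}
    (hq : n * (Fintype.card F - 1) = Fintype.card F ^ m - 1) (hn : 4 ≤ n)
    (v : Fin n → (Fin m → F)) (hv : IsHammingMatrix v) (t1 : Fin n) :
    Nat.card {i : Fin n // i ∉ ({t1} : Finset (Fin n))} = n - 1 ∧
    Module.finrank F ↥(dualCode (shortenedCode (hammingCode v) {t1})) = m ∧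
    IsMinDist (dualCode (shortenedCode (hammingCode v) {t1}))
      (Fintype.card F ^ (m - 1) - 1) ∧
    weightCount (dualCode (shortenedCode (hammingCode v) {t1})) 0 = 1 ∧
    weightCount (dualCode (shortenedCode (hammingCode v) {t1}))
      (Fintype.card F ^ (m - 1) - 1) = (Fintype.card F - 1) * Fintype.card F ^ (m - 1) ∧
    weightCount (dualCode (shortenedCode (hammingCode v) {t1}))
      (Fintype.card F ^ (m - 1)) = Fintype.card F ^ (m - 1) - 1 ∧
    ∀ k : ℕ, k ≠ 0 → k ≠ Fintype.card F ^ (m - 1) - 1 → k ≠ Fintype.card F ^ (m - 1) →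
      weightCount (dualCode (shortenedCode (hammingCode v) {t1})) k = 0 := by
  classical
  set q := Fintype.card F with hqdef
  have hq2 : 2 ≤ q := Fintype.one_lt_card (α := F)
  have hm : 2 ≤ m := by
    by_contra hlt
    have : m = 0 ∨ m = 1 := by omega
    rcases this with rfl | rfl
    · simp at hq; omega
    · rw [pow_one] at hq
      have : 4 * (q - 1) ≤ n * (q - 1) := Nat.mul_le_mul_right _ hn
      omega
  have hQ : 3 ≤ q ^ (m - 1) := by
    by_contra hlt
    have h1 : q ≤ q ^ (m - 1) := Nat.le_self_pow (by omega) q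
    have hqq : q = 2 := by omega
    have hp : q ^ m = q ^ (m - 1) * q := by rw [← pow_succ]; congr 1; omega
    rw [hp] at hq
    have : q ^ (m - 1) = 2 := by omega
    rw [this, hqq] at hq
    omega
  set Q := q ^ (m - 1) with hQdef
  have hW := weight_ev v hv t1
  rw [← hqdef, ← hQdef] at hW
  have hinj : Function.Injective (evMap v t1) := by
    rw [injective_iff_map_eq_zero]
    intro u h
    by_contra hu
    have := hW u hu
    rw [h, hammingNorm_zero] at this
    split_ifs at this <;> omega
  have h0 : hammingNorm (evMap v t1 0) = 0 := by simp
  have hcount : ∀ k, weightCount (dualCode (shortenedCode (hammingCode v) {t1})) k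
      = #{u : Fin m → F | hammingNorm (evMap v t1 u) = k} := by
    intro k
    rw [weightCount, ← Fintype.card_subtype, ← Nat.card_eq_fintype_card]
    symm
    refine Nat.card_congr (Equiv.ofBijective
      (fun u => ⟨evMap v t1 u.1, by rw [dual_eq]; exact ⟨_, rfl⟩, u.2⟩) ⟨?_, ?_⟩)
    · intro a b hab
      exact Subtype.ext (hinj (congrArg Subtype.val hab))
    · rintro ⟨c, hc, hk⟩
      rw [dual_eq] at hc
      obtain ⟨u, rfl⟩ := hc
      exact ⟨⟨u, hk⟩, rfl⟩
  have hA : weightCount (dualCode (shortenedCode (hammingCode v) {t1})) (Q - 1)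
      = (q - 1) * Q := by
    rw [hcount, hQdef, hqdef, ← card_nker (v t1) (hv.1 t1), ← hqdef, ← hQdef]
    congr 1
    ext u
    simp only [Finset.mem_filter, Finset.mem_univ, true_and]
    by_cases hu : u = 0
    · subst hu; simp; omega
    · rw [hW u hu]
      split_ifs with h <;> simp [h]
      omega
  refine ⟨by simp, ?_, ⟨?_, ?_⟩, ?_, hA, ?_, ?_⟩
  · rw [dual_eq, LinearMap.finrank_range_of_inj hinj]; simp
  · have hpos : 0 < weightCount (dualCode (shortenedCode (hammingCode v) {t1})) (Q - 1) := by
      rw [hA]; exact Nat.mul_pos (by omega) (by omega)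
    rw [weightCount] at hpos
    obtain ⟨⟨⟨c, hc, hk⟩⟩, -⟩ := Nat.card_pos_iff.1 hpos
    refine ⟨c, hc, ?_, hk⟩
    rintro rfl
    rw [hammingNorm_zero] at hk
    omega
  · intro c hc hne
    rw [dual_eq] at hc
    obtain ⟨u, rfl⟩ := hc
    have hu : u ≠ 0 := by rintro rfl; simp at hne
    rw [hW u hu]
    split_ifs <;> omega
  · rw [hcount, Finset.card_eq_one]
    refine ⟨0, ?_⟩
    ext u
    simp only [Finset.mem_filter, Finset.mem_univ, true_and, Finset.mem_singleton,
      hammingNorm_eq_zero]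
    exact map_eq_zero_iff _ hinj
  · rw [hcount]
    have : ({u : Fin m → F | hammingNorm (evMap v t1 u) = Q} : Finset _)
        = ({u : Fin m → F | ∑ j, u j * v t1 j = 0} : Finset _).erase 0 := by
      ext u
      simp only [Finset.mem_filter, Finset.mem_univ, true_and, Finset.mem_erase]
      by_cases hu : u = 0
      · subst hu; simp; omega
      · rw [hW u hu]
        split_ifs with h <;> simp [h, hu]
        omega
    rw [this, Finset.card_erase_of_mem (by simp), card_ker _ (hv.1 t1)]
  · intro k hk0 hk1 hk2
    rw [hcount, Finset.card_eq_zero, Finset.filter_eq_empty_iff]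
    intro u _ h
    by_cases hu : u = 0
    · subst hu; rw [h0] at h; exact hk0 h.symm
    · rw [hW u hu] at h
      split_ifs at h
      · exact hk2 h.symm
      · exact hk1 h.symm
end

section
/- Let m ≥ 3, n = (q^m−1)/(q−1) ≥ 6, and let t_1 and t_2 be any two distinct coordinate positions. Then the dual code ((H_{(q,m)})_{{t_1,t_2}})^⊥ of the twice-shortened Hamming code is an [n−2, m, q^{m−1}−2] code over GF(q) with weight enumerator 1 + (q−1)^2 q^{m−2} z^{q^{m−1}−2} + 2(q−1)q^{m−2} z^{q^{m−1}−1} + (q^{m−2}−1) z^{q^{m−1}}. -/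
open Finset

theorem aux_fiber {F V W : Type} [Field F] [AddCommGroup V] [Module F V] [AddCommGroup W]
    [Module F W] [Fintype V] [Fintype W] [DecidableEq W] (f : V →ₗ[F] W)
    (hf : Function.Surjective f) (y : W) :
    (univ.filter (fun x => f x = y)).card * Fintype.card W = Fintype.card V := by
  have h1 : ∀ z : W, (univ.filter (fun x => f x = z)).card
      = (univ.filter (fun x => f x = y)).card := by
    intro z
    obtain ⟨d, hd⟩ := hf (y - z)
    refine Finset.card_bij (fun x _ => x + d) ?_ ?_ ?_
    · intro x hx
      simp only [mem_filter, mem_univ, true_and] at hx ⊢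
      rw [map_add, hx, hd]; abel
    · intro a _ b _ h
      exact add_right_cancel h
    · intro b hb
      simp only [mem_filter, mem_univ, true_and] at hb
      refine ⟨b - d, ?_, by abel⟩
      simp only [mem_filter, mem_univ, true_and]
      rw [map_sub, hb, hd]; abel
  have h2 := Finset.card_eq_sum_card_fiberwise (f := f) (s := univ) (t := univ)
    (fun x _ => by simp)
  rw [Finset.sum_congr rfl (fun z _ => h1 z)] at h2
  simp only [sum_const, card_univ, smul_eq_mul] at h2
  rw [h2, mul_comm]

theorem aux_pair {F : Type} [Field F] {m n : ℕ}
    (v : Fin n → (Fin m → F)) (hv : IsHammingMatrix v) (t1 t2 : Fin n) (c : F)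
    (h : v t1 = c • v t2) : t1 = t2 := by
  obtain ⟨i, _, hu⟩ := hv.2 (v t1) (hv.1 t1)
  rw [hu t1 ⟨1, by simp⟩, hu t2 ⟨c, h⟩]

/-- the functional of dotting with w -/
def dotL {F : Type} [Field F] {m : ℕ} (w : Fin m → F) : (Fin m → F) →ₗ[F] F where
  toFun a := ∑ j, a j * w j
  map_add' a b := by simp [add_mul, Finset.sum_add_distrib]
  map_smul' r a := by simp [Finset.mul_sum, mul_assoc]

theorem dotL_apply {F : Type} [Field F] {m : ℕ} (w a : Fin m → F) :
    dotL w a = ∑ j, a j * w j := rfl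

theorem dotL_comm {F : Type} [Field F] {m : ℕ} (w a : Fin m → F) :
    dotL w a = dotL a w := by
  simp [dotL_apply, mul_comm]

theorem dotL_ne {F : Type} [Field F] {m : ℕ} (w : Fin m → F) (hw : w ≠ 0) :
    Function.Surjective (dotL w) := by
  apply LinearMap.surjective
  intro h
  apply hw
  funext j
  have := LinearMap.congr_fun h (Pi.single j 1)
  simpa [dotL_apply, Pi.single_apply] using this

theorem aux_surj_s10 {F : Type} [Field F] {m n : ℕ}
    (v : Fin n → (Fin m → F)) (hv : IsHammingMatrix v) (t1 t2 : Fin n) (h12 : t1 ≠ t2) :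
    Function.Surjective ((dotL (v t1)).prod (dotL (v t2))) := by
  rw [← LinearMap.range_eq_top]
  by_contra hne
  obtain ⟨f, hf0, hf⟩ := Submodule.exists_le_ker_of_lt_top _ (lt_top_iff_ne_top.2 hne)
  have hfx : ∀ x y : F, f (x, y) = x * f (1, 0) + y * f (0, 1) := by
    intro x y
    have : ((x, y) : F × F) = x • (1, 0) + y • (0, 1) := by simp
    rw [this, map_add, map_smul, map_smul]; simp
  have hz : f (1, 0) • v t1 + f (0, 1) • v t2 = 0 := by
    funext j
    have h : f (dotL (v t1) (Pi.single j 1), dotL (v t2) (Pi.single j 1)) = 0 := by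
      have := hf (LinearMap.mem_range_self ((dotL (v t1)).prod (dotL (v t2))) (Pi.single j 1))
      simpa using this
    rw [hfx] at h
    simp [dotL_apply, Pi.single_apply] at h
    simp only [Pi.add_apply, Pi.smul_apply, smul_eq_mul, Pi.zero_apply]
    linear_combination h
  by_cases hc : f (1, 0) = 0
  · by_cases hd : f (0, 1) = 0
    · apply hf0
      ext <;> simp [hc, hd]
    · rw [hc, zero_smul, zero_add] at hz
      exact hv.1 t2 ((smul_eq_zero.1 hz).resolve_left hd)
  · apply h12
    apply aux_pair v hv t1 t2 (-(f (1, 0))⁻¹ * f (0, 1))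
    funext j
    have := congrFun hz j
    simp only [Pi.add_apply, Pi.smul_apply, smul_eq_mul, Pi.zero_apply] at this ⊢
    field_simp
    linear_combination this

theorem aux_weight_s10 {F : Type} [Field F] [Fintype F] [DecidableEq F] {m n : ℕ} (hm : 1 ≤ m)
    (v : Fin n → (Fin m → F)) (hv : IsHammingMatrix v) (a : Fin m → F) (ha : a ≠ 0) :
    (univ.filter (fun i => dotL (v i) a ≠ 0)).card = Fintype.card F ^ (m - 1) := by
  have hF : 1 < Fintype.card F := Fintype.one_lt_card
  have h0 := aux_fiber (dotL a) (dotL_ne a ha) 0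
  have hsp := Finset.card_filter_add_card_filter_not (s := (univ : Finset (Fin m → F)))
    (fun x => dotL a x = 0)
  have hb : ((univ : Finset Fˣ) ×ˢ univ.filter (fun i => dotL (v i) a ≠ 0)).card
      = (univ.filter (fun w => ¬ dotL a w = 0)).card := by
    refine Finset.card_bij (fun p _ => (p.1 : F) • v p.2) ?_ ?_ ?_
    · rintro ⟨c, i⟩ h
      simp only [mem_product, mem_filter, mem_univ, true_and] at h ⊢
      rw [map_smul, dotL_comm, smul_eq_mul]
      exact mul_ne_zero c.ne_zero h
    · rintro ⟨c, i⟩ _ ⟨d, j⟩ _ h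
      simp only at h
      have hij : i = j := by
        apply aux_pair v hv i j ((c : F)⁻¹ * d)
        rw [mul_smul, ← h, smul_smul, inv_mul_cancel₀ c.ne_zero, one_smul]
      subst hij
      have := smul_left_injective F (hv.1 i) h
      rw [Units.ext this]
    · intro w hw
      simp only [mem_filter, mem_univ, true_and] at hw
      have hw0 : w ≠ 0 := by rintro rfl; simp at hw
      obtain ⟨i, ⟨c, hc⟩, _⟩ := hv.2 w hw0
      have hc0 : c ≠ 0 := by rintro rfl; simp at hc; exact hw0 hc
      refine ⟨(Units.mk0 c hc0, i), ?_, by simp [hc]⟩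
      simp only [mem_product, mem_filter, mem_univ, true_and]
      rw [dotL_comm]
      intro h
      apply hw
      rw [hc, map_smul, h, smul_zero]
  rw [Finset.card_product, Finset.card_univ, Fintype.card_units] at hb
  simp only [card_univ, Fintype.card_fun, Fintype.card_fin] at h0 hsp
  obtain ⟨k, rfl⟩ : ∃ k, m = k + 1 := ⟨m - 1, by omega⟩
  obtain ⟨r, hr⟩ : ∃ r, Fintype.card F = r + 2 := ⟨Fintype.card F - 2, by omega⟩
  rw [← hb] at hsp
  simp only [Nat.add_sub_cancel]
  rw [hr, pow_succ] at h0 hsp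
  rw [hr]
  have h0' := Nat.eq_of_mul_eq_mul_right (by omega) h0
  rw [h0'] at hsp
  have : r + 2 - 1 = r + 1 := rfl
  rw [this] at hsp
  apply Nat.eq_of_mul_eq_mul_left (show 0 < r + 1 by omega)
  nlinarith

/-- the encoder of the punctured simplex code -/
def encL {F : Type} [Field F] {m n : ℕ} (v : Fin n → (Fin m → F)) (T : Finset (Fin n)) :
    (Fin m → F) →ₗ[F] ({i : Fin n // i ∉ T} → F) :=
  LinearMap.pi (fun i => dotL (v i.1))

theorem encL_apply {F : Type} [Field F] {m n : ℕ} (v : Fin n → (Fin m → F))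
    (T : Finset (Fin n)) (a) (i) : encL v T a i = dotL (v i.1) a := rfl

theorem aux_range {F : Type} [Field F] {m n : ℕ}
    (v : Fin n → (Fin m → F)) (T : Finset (Fin n)) :
    dualCode (shortenedCode (hammingCode v) T) = LinearMap.range (encL v T) := by
  classical
  ext x
  constructor
  · intro hx
    -- check map on the remaining columns
    let A : ({i : Fin n // i ∉ T} → F) →ₗ[F] (Fin m → F) :=
      Fintype.linearCombination F (fun i : {i : Fin n // i ∉ T} => v i.1)
    let φ : Module.Dual F ({i : Fin n // i ∉ T} → F) :=
      Fintype.linearCombination F x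
    have hφ : ∀ c, φ c = ∑ i, x i * c i := by
      intro c
      simp [φ, Fintype.linearCombination_apply, mul_comm]
    have hmem : φ ∈ (LinearMap.ker A).dualAnnihilator := by
      rw [Submodule.mem_dualAnnihilator]
      intro c hc
      rw [hφ]
      apply hx
      refine ⟨fun i => if h : i ∉ T then c ⟨i, h⟩ else 0, ⟨?_, ?_⟩, ?_⟩
      · change checkMap v _ = 0
        funext j
        have hc' := congrFun (LinearMap.mem_ker.1 hc) j
        simp only [A, Fintype.linearCombination_apply, Finset.sum_apply, Pi.smul_apply,
          smul_eq_mul, Pi.zero_apply] at hc'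
        change ∑ i, _ * v i j = 0
        refine Eq.trans ?_ hc'
        have hs := Finset.sum_subtype (F := inferInstance) (univ.filter (fun i => i ∉ T))
          (p := fun i => i ∉ T) (by simp)
          (fun i => (if h : i ∉ T then c ⟨i, h⟩ else 0) * v i j)
        rw [Finset.sum_filter_of_ne] at hs
        · rw [hs]
          apply Finset.sum_congr rfl
          intro i _
          rw [dif_pos i.2]
        · intro i _ h hi
          exact h (by simp [hi])
      · intro i hi
        simp [hi]
      · funext i
        change (if h : i.1 ∉ T then c ⟨i.1, h⟩ else 0) = c i
        rw [dif_pos i.2]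
    rw [← LinearMap.range_dualMap_eq_dualAnnihilator_ker] at hmem
    obtain ⟨g, hg⟩ := hmem
    refine ⟨fun j => g (Pi.single j 1), ?_⟩
    funext i
    have h1 := LinearMap.congr_fun hg (Pi.single i 1)
    rw [hφ] at h1
    simp only [LinearMap.dualMap_apply, A, Fintype.linearCombination_apply_single, one_smul] at h1
    rw [Finset.sum_eq_single i (by intro b _ hb; simp [hb]) (by simp)] at h1
    rw [Pi.single_eq_same, mul_one] at h1
    rw [encL_apply, dotL_apply, ← h1]
    conv_rhs => rw [pi_eq_sum_univ' (v i.1), map_sum]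
    apply Finset.sum_congr rfl
    intro j _
    rw [map_smul, smul_eq_mul, mul_comm]
  · rintro ⟨a, rfl⟩ c ⟨d, ⟨hd, hd0⟩, rfl⟩
    have hd' : ∀ j, ∑ i, d i * v i j = 0 := fun j => congrFun (show checkMap v d = 0 from hd) j
    have h1 : ∑ i, dotL (v i) a * d i = 0 := by
      simp only [dotL_apply, Finset.sum_mul]
      rw [Finset.sum_comm]
      apply Finset.sum_eq_zero
      intro j _
      have : ∑ i, a j * v i j * d i = a j * ∑ i, d i * v i j := by
        rw [Finset.mul_sum]; exact Finset.sum_congr rfl (fun i _ => by ring)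
      rw [this, hd', mul_zero]
    rw [← h1]
    change ∑ i : {i : Fin n // i ∉ T}, dotL (v i.1) a * d i.1 = _
    rw [← Finset.sum_subtype (univ.filter (fun i => i ∉ T)) (by simp)
      (fun i => dotL (v i) a * d i)]
    rw [Finset.sum_filter_of_ne]
    intro i _ h hi
    exact h (by rw [hd0 i hi, mul_zero])

theorem aux_norm_s10 {F : Type} [Field F] [Fintype F] [DecidableEq F] {m n : ℕ} (hm : 1 ≤ m)
    (v : Fin n → (Fin m → F)) (hv : IsHammingMatrix v) (t1 t2 : Fin n) (h12 : t1 ≠ t2)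
    (a : Fin m → F) (ha : a ≠ 0) :
    hammingNorm (encL v {t1, t2} a) + ((if dotL (v t1) a ≠ 0 then 1 else 0) +
      (if dotL (v t2) a ≠ 0 then 1 else 0)) = Fintype.card F ^ (m - 1) := by
  rw [← aux_weight_s10 hm v hv a ha]
  have h1 : hammingNorm (encL v {t1, t2} a) =
      ∑ i : {i : Fin n // i ∉ ({t1, t2} : Finset (Fin n))},
        (if dotL (v i.1) a ≠ 0 then 1 else 0) := by
    rw [hammingNorm, Finset.card_filter]; rfl
  rw [h1, Finset.card_filter, ← Finset.sum_subtype (univ.filter (fun i => i ∉ ({t1, t2} : Finset (Fin n)))) (by simp)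
      (fun i => if dotL (v i) a ≠ 0 then 1 else 0), ← Finset.sum_pair h12
      (f := fun i => if dotL (v i) a ≠ 0 then 1 else 0)]
  rw [← Finset.sum_filter_not_add_sum_filter univ (fun i => i ∈ ({t1, t2} : Finset (Fin n)))]
  congr 2
  ext i; simp

theorem aux_count_s10 {F : Type} [Field F] [Fintype F] [DecidableEq F] {m n : ℕ} (hm : 3 ≤ m)
    (v : Fin n → (Fin m → F)) (hv : IsHammingMatrix v) (t1 t2 : Fin n) (h12 : t1 ≠ t2)
    (S : Finset (F × F)) :
    (univ.filter (fun a => (dotL (v t1) a, dotL (v t2) a) ∈ S)).card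
      = S.card * Fintype.card F ^ (m - 2) := by
  have hF : 1 < Fintype.card F := Fintype.one_lt_card
  rw [Finset.card_eq_sum_card_fiberwise (f := fun a => (dotL (v t1) a, dotL (v t2) a)) (t := S)
    (fun x hx => by simpa using hx)]
  rw [← smul_eq_mul, ← Finset.sum_const]
  apply Finset.sum_congr rfl
  intro y hy
  have h := aux_fiber _ (aux_surj_s10 v hv t1 t2 h12) y
  simp only [Fintype.card_prod, Fintype.card_fun, Fintype.card_fin] at h
  obtain ⟨k, rfl⟩ : ∃ k, m = k + 2 := ⟨m - 2, by omega⟩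
  rw [pow_add, pow_two] at h
  have h' := Nat.eq_of_mul_eq_mul_right (by positivity) h
  rw [Nat.add_sub_cancel, ← h', Finset.filter_filter]
  congr 1
  ext a
  simp only [mem_filter, mem_univ, true_and, LinearMap.prod_apply, Function.prod]
  constructor
  · exact fun h => h.2
  · intro h; exact ⟨by rw [h]; exact hy, h⟩

/-- The dual `((H_{(q,m)})_{{t₁,t₂}})^⊥` of the twice-shortened Hamming code is an
`[n-2, m, q^{m-1}-2]` code with weight enumerator
`1 + (q-1)² q^{m-2} z^{q^{m-1}-2} + 2(q-1)q^{m-2} z^{q^{m-1}-1} + (q^{m-2}-1) z^{q^{m-1}}`. -/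
theorem statement10 {F : Type} [Field F] [Fintype F] [DecidableEq F] {m n : ℕ}
    (hm : 3 ≤ m) (hq : n * (Fintype.card F - 1) = Fintype.card F ^ m - 1) (hn : 6 ≤ n)
    (v : Fin n → (Fin m → F)) (hv : IsHammingMatrix v) (t1 t2 : Fin n) (h12 : t1 ≠ t2) :
    Nat.card {i : Fin n // i ∉ ({t1, t2} : Finset (Fin n))} = n - 2 ∧
    Module.finrank F ↥(dualCode (shortenedCode (hammingCode v) {t1, t2})) = m ∧
    IsMinDist (dualCode (shortenedCode (hammingCode v) {t1, t2}))
      (Fintype.card F ^ (m - 1) - 2) ∧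
    weightCount (dualCode (shortenedCode (hammingCode v) {t1, t2})) 0 = 1 ∧
    weightCount (dualCode (shortenedCode (hammingCode v) {t1, t2}))
        (Fintype.card F ^ (m - 1) - 2)
      = (Fintype.card F - 1) ^ 2 * Fintype.card F ^ (m - 2) ∧
    weightCount (dualCode (shortenedCode (hammingCode v) {t1, t2}))
        (Fintype.card F ^ (m - 1) - 1)
      = 2 * (Fintype.card F - 1) * Fintype.card F ^ (m - 2) ∧
    weightCount (dualCode (shortenedCode (hammingCode v) {t1, t2}))
        (Fintype.card F ^ (m - 1))
      = Fintype.card F ^ (m - 2) - 1 ∧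
    ∀ k : ℕ, k ≠ 0 → k ≠ Fintype.card F ^ (m - 1) - 2 →
      k ≠ Fintype.card F ^ (m - 1) - 1 → k ≠ Fintype.card F ^ (m - 1) →
      weightCount (dualCode (shortenedCode (hammingCode v) {t1, t2})) k = 0 := by
  classical
  have hF : 1 < Fintype.card F := Fintype.one_lt_card
  have hQ : 4 ≤ Fintype.card F ^ (m - 1) :=
    calc 4 = 2 ^ 2 := by norm_num
      _ ≤ Fintype.card F ^ 2 := Nat.pow_le_pow_left hF 2
      _ ≤ _ := Nat.pow_le_pow_right (by omega) (by omega)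
  have hN := aux_norm_s10 (by omega) v hv t1 t2 h12
  have hC := aux_count_s10 hm v hv t1 t2 h12
  have hinj : Function.Injective (encL v {t1, t2}) := by
    rw [← LinearMap.ker_eq_bot, LinearMap.ker_eq_bot']
    intro a ha
    by_contra h0
    have := hN a h0
    rw [ha, hammingNorm_zero] at this
    split_ifs at this <;> omega
  have hW : ∀ k, weightCount (dualCode (shortenedCode (hammingCode v) {t1, t2})) k
      = (univ.filter (fun a => hammingNorm (encL v {t1, t2} a) = k)).card := by
    intro k
    rw [weightCount, aux_range, ← Fintype.card_subtype, ← Nat.card_eq_fintype_card]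
    symm
    refine Nat.card_congr (Equiv.ofBijective
      (fun a => ⟨encL v {t1, t2} a.1, LinearMap.mem_range_self _ _, a.2⟩) ⟨?_, ?_⟩)
    · intro a b h
      exact Subtype.ext (hinj (congrArg Subtype.val h))
    · rintro ⟨c, ⟨a, rfl⟩, hc⟩
      exact ⟨⟨a, hc⟩, rfl⟩
  have hn0 : hammingNorm (encL v {t1, t2} 0) = 0 := by simp
  have e2 : ∀ a, hammingNorm (encL v {t1, t2} a) = Fintype.card F ^ (m - 1) - 2 ↔
      (dotL (v t1) a, dotL (v t2) a) ∈ (univ.erase (0 : F)) ×ˢ (univ.erase (0 : F)) := by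
    intro a
    by_cases ha : a = 0
    · subst ha; rw [hn0]; simp; omega
    · have := hN a ha
      simp only [mem_product, mem_erase, mem_univ, and_true]
      split_ifs at this <;> simp_all <;> omega
  have e1 : ∀ a, hammingNorm (encL v {t1, t2} a) = Fintype.card F ^ (m - 1) - 1 ↔
      (dotL (v t1) a, dotL (v t2) a) ∈
        ((univ.erase (0 : F)) ×ˢ {0}) ∪ ({0} ×ˢ (univ.erase (0 : F))) := by
    intro a
    by_cases ha : a = 0
    · subst ha; rw [hn0]; simp; omega
    · have := hN a ha
      simp only [mem_union, mem_product, mem_erase, mem_univ, and_true, mem_singleton]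
      split_ifs at this <;> simp_all <;> omega
  have e0 : ∀ a, hammingNorm (encL v {t1, t2} a) = Fintype.card F ^ (m - 1) ↔
      a ≠ 0 ∧ (dotL (v t1) a, dotL (v t2) a) ∈ ({(0, 0)} : Finset (F × F)) := by
    intro a
    by_cases ha : a = 0
    · subst ha; rw [hn0]; simp; omega
    · have := hN a ha
      simp only [mem_singleton, Prod.mk.injEq]
      split_ifs at this <;> simp_all <;> omega
  have c2 : weightCount (dualCode (shortenedCode (hammingCode v) {t1, t2}))
        (Fintype.card F ^ (m - 1) - 2)
      = (Fintype.card F - 1) ^ 2 * Fintype.card F ^ (m - 2) := by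
    rw [hW]
    simp only [e2]
    rw [hC, Finset.card_product, Finset.card_erase_of_mem (mem_univ _), Finset.card_univ, pow_two]
  refine ⟨?_, ?_, ⟨?_, ?_⟩, ?_, c2, ?_, ?_, ?_⟩
  · rw [Nat.card_eq_fintype_card, Fintype.card_subtype_compl, Fintype.card_coe,
      Finset.card_pair h12, Fintype.card_fin]
  · rw [aux_range, LinearMap.finrank_range_of_inj hinj]; simp
  · have hpos : 0 < weightCount (dualCode (shortenedCode (hammingCode v) {t1, t2}))
        (Fintype.card F ^ (m - 1) - 2) := by
      rw [c2]
      have : 0 < Fintype.card F - 1 := by omega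
      positivity
    obtain ⟨⟨c, hc, hk⟩⟩ := (Nat.card_pos_iff.1 hpos).1
    refine ⟨c, hc, ?_, hk⟩
    rintro rfl
    rw [hammingNorm_zero] at hk
    omega
  · intro c hc hc0
    rw [aux_range] at hc
    obtain ⟨a, rfl⟩ := hc
    have ha : a ≠ 0 := by rintro rfl; simp at hc0
    have := hN a ha
    split_ifs at this <;> omega
  · rw [hW, Finset.card_eq_one]
    refine ⟨0, ?_⟩
    ext a
    simp only [mem_filter, mem_univ, true_and, mem_singleton, hammingNorm_eq_zero]
    exact map_eq_zero_iff _ hinj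
  · rw [hW]
    simp only [e1]
    rw [hC, Finset.card_union_of_disjoint, Finset.card_product, Finset.card_product,
      Finset.card_erase_of_mem (mem_univ _), Finset.card_univ, Finset.card_singleton]
    · ring
    · rw [Finset.disjoint_left]
      rintro ⟨x, y⟩ h1 h2
      simp only [mem_product, mem_erase, mem_singleton] at h1 h2
      exact h1.1.1 h2.1
  · rw [hW]
    simp only [e0]
    have := hC {(0, 0)}
    rw [Finset.card_singleton, one_mul] at this
    rw [← this, ← Finset.card_erase_of_mem (a := 0) (by simp)]
    congr 1
    ext a; simp
  · intro k hk0 hk2 hk1 hk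
    rw [hW, Finset.card_eq_zero, Finset.filter_eq_empty_iff]
    intro a _ h
    by_cases ha : a = 0
    · subst ha; rw [hn0] at h; omega
    · have := hN a ha
      split_ifs at this <;> omega
end
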